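/- arXiv:1707.04843 — 10 statements merged into one kernel-verified Lean document; each statement's English description precedes it below -/
import Mathlib

section
/- Let F be a field with algebraic closure F̄, and let Q(λ) ∈ F[λ]^{m×n} with m ≤ n be a matrix polynomial such that for every λ0 ∈ F̄ the evaluated matrix Q(λ0) ∈ F̄^{m×n} (obtained by mapping coefficients into F̄ and evaluating each entry at λ0) has full row rank m. Then there exists a matrix polynomial Q̃(λ) ∈ F[λ]^{(n−m)×n} such that the n×n matrix polynomial obtained by stacking Q(λ) on top of Q̃(λ) is unimodular. -/
open Polynomial Matrix

/-- Evaluation of a matrix polynomial over `F` at a point of an `F`-algebra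
(entrywise evaluation after mapping the coefficients into the algebra). -/
noncomputable def evalMat {F : Type*} [Field F] {A : Type*} [CommRing A] [Algebra F A]
    {ι κ : Type*} (Q : Matrix ι κ (Polynomial F)) (x : A) : Matrix ι κ A :=
  Matrix.of fun i j => Polynomial.aeval x (Q i j)

lemma aux_surj (F : Type*) [Field F] (m n : ℕ)
    (Q : Matrix (Fin m) (Fin n) (Polynomial F))
    (hfull : ∀ x : AlgebraicClosure F, (evalMat Q x).rank = m) :
    Function.Surjective Q.mulVecLin := by
  classical
  rw [← LinearMap.range_eq_top]
  obtain ⟨k, snf⟩ := Submodule.smithNormalForm (Pi.basisFun F[X] (Fin m))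
    (LinearMap.range Q.mulVecLin)
  have key : ∀ (j : Fin m) (p : F[X]), (∀ y ∈ LinearMap.range Q.mulVecLin,
      p ∣ snf.bM.repr y j) → IsUnit p := by
    intro j p hp
    by_contra hu
    obtain ⟨x, hx⟩ : ∃ x : AlgebraicClosure F, aeval x p = 0 := by
      by_cases h0 : p = 0
      · exact ⟨0, by simp [h0]⟩
      · apply IsAlgClosed.exists_aeval_eq_zero
        intro hd
        exact hu (Polynomial.isUnit_iff_degree_eq_zero.2 hd)
    set v : Fin m → F[X] := fun i => snf.bM.repr (Pi.single i 1) j with hv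
    have hphi : ∀ y : Fin m → F[X], snf.bM.repr y j = ∑ i, y i * v i := by
      intro y
      conv_lhs => rw [pi_eq_sum_univ' y]
      simp [hv, Finsupp.finsetSum_apply]
    have hrows : LinearIndependent (AlgebraicClosure F) (evalMat Q x).row := by
      rw [linearIndependent_iff_card_eq_finrank_span, Set.finrank,
        ← Matrix.rank_eq_finrank_span_row, hfull, Fintype.card_fin]
    have hz : ∀ i, aeval x (v i) = 0 := by
      refine Fintype.linearIndependent_iff.1 hrows (fun i => aeval x (v i)) ?_
      ext c
      have h1 := hp (Q.mulVecLin (Pi.single c 1)) ⟨_, rfl⟩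
      rw [hphi] at h1
      obtain ⟨q, hq⟩ := h1
      have h2 := congrArg (aeval x) hq
      simp only [map_sum, map_mul, hx, zero_mul] at h2
      simp only [Finset.sum_apply, Pi.smul_apply, smul_eq_mul, Pi.zero_apply]
      rw [← h2]
      refine Finset.sum_congr rfl fun i _ => ?_
      simp [evalMat, Matrix.row, mul_comm]
    have h3 := congrArg (aeval x) (hphi (snf.bM j))
    simp [hz] at h3
  rw [eq_top_iff, ← snf.bM.span_eq, Submodule.span_le]
  rintro _ ⟨j, rfl⟩
  by_cases hj : j ∈ Set.range snf.f
  · obtain ⟨i, rfl⟩ := hj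
    have hu := key (snf.f i) (snf.a i) (fun y hy => by
      have := snf.repr_apply_embedding_eq_repr_smul (m := ⟨y, hy⟩) (i := i)
      simp only [map_smul, Finsupp.smul_apply, smul_eq_mul] at this
      exact ⟨_, this⟩)
    obtain ⟨u, hu⟩ := hu
    have h := (snf.bN i).2
    rw [snf.snf, ← hu] at h
    have := Submodule.smul_mem _ (↑u⁻¹ : F[X]) h
    simpa [smul_smul] using this
  · exfalso
    have := key j 0 (fun y hy => by
      rw [snf.repr_eq_zero_of_notMem_range ⟨y, hy⟩ hj])
    simp at this

/-- If `Q(λ) ∈ F[λ]^{m×n}` (`m ≤ n`) has full row rank at every point of the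
algebraic closure of `F`, then it can be completed, by stacking a matrix polynomial
`Q̃(λ) ∈ F[λ]^{(n-m)×n}` below it, to a unimodular `n×n` matrix polynomial
(one whose determinant is a unit of `F[λ]`, i.e. a nonzero constant). -/
theorem statement_0 (F : Type*) [Field F] (m n : ℕ) (hmn : m ≤ n)
    (Q : Matrix (Fin m) (Fin n) (Polynomial F))
    (hfull : ∀ x : AlgebraicClosure F, (evalMat Q x).rank = m) :
    ∃ Qt : Matrix (Fin (n - m)) (Fin n) (Polynomial F),
      IsUnit ((Matrix.fromRows Q Qt).submatrix
        (fun i : Fin n => finSumFinEquiv.symm (finCongr (Nat.add_sub_cancel' hmn).symm i))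
        id).det := by
  classical
  have hs := aux_surj F m n Q hfull
  obtain ⟨s, hs1⟩ := Module.projective_lifting_property Q.mulVecLin LinearMap.id hs
  have hs2 : ∀ y, Q *ᵥ (s y) = y := fun y => by
    simpa using LinearMap.congr_fun hs1 y
  have hrank : Module.finrank F[X] (LinearMap.ker Q.mulVecLin) = n - m := by
    have := (LinearMap.ker Q.mulVecLin).finrank_quotient_add_finrank
    rw [(Q.mulVecLin.quotKerEquivOfSurjective hs).finrank_eq] at this
    simp at this
    omega
  let b := Module.finBasisOfFinrankEq F[X] (LinearMap.ker Q.mulVecLin) hrank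
  let g : (Fin n → F[X]) →ₗ[F[X]] LinearMap.ker Q.mulVecLin :=
    LinearMap.codRestrict _ (LinearMap.id - s ∘ₗ Q.mulVecLin) (fun x => by
      simp [LinearMap.mem_ker, Matrix.mulVec_sub, hs2])
  let G : (Fin n → F[X]) →ₗ[F[X]] (Fin (n - m) → F[X]) := b.equivFun.toLinearMap ∘ₗ g
  have hGs : ∀ y, G (s y) = 0 := fun y => by
    have : g (s y) = 0 := by
      apply Subtype.ext
      change s y - s (Q *ᵥ s y) = 0
      rw [hs2, sub_self]
    simp [G, this]
  have hGb : ∀ i, G (b i : Fin n → F[X]) = Pi.single i 1 := fun i => by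
    have : g (b i : Fin n → F[X]) = b i := by
      apply Subtype.ext
      have h := (b i).2
      rw [LinearMap.mem_ker, Matrix.mulVecLin_apply] at h
      change (b i : Fin n → F[X]) - s (Q *ᵥ (b i : Fin n → F[X])) = b i
      rw [h, map_zero, sub_zero]
    ext j
    simp [G, this, Finsupp.single_apply, Pi.single_apply, eq_comm]
  have hQb : ∀ i, Q *ᵥ (b i : Fin n → F[X]) = 0 := fun i => by
    have h := (b i).2
    rwa [LinearMap.mem_ker, Matrix.mulVecLin_apply] at h
  let S := LinearMap.toMatrix' s
  let B : Matrix (Fin n) (Fin (n - m)) F[X] := Matrix.of fun i j => (b j : Fin n → F[X]) i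
  have hG : ∀ y, LinearMap.toMatrix' G *ᵥ y = G y := fun y => by
    rw [LinearMap.toMatrix'_mulVec]
  have hBc : ∀ j, (fun i => B i j) = (b j : Fin n → F[X]) := fun j => rfl
  have hSc : ∀ j, (fun i => S i j) = s (Pi.single j 1) := fun j => by
    ext i; simp [S, LinearMap.toMatrix'_apply]
  have h11 : Q * S = 1 := by
    refine Matrix.ext fun i j => ?_
    have := congrFun (hs2 (Pi.single j 1)) i
    rw [← hSc, Pi.single_apply] at this
    rw [Matrix.one_apply]
    exact this
  have h12 : Q * B = 0 := by
    refine Matrix.ext fun i j => ?_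
    exact congrFun (hQb j) i
  have h21 : LinearMap.toMatrix' G * S = 0 := by
    refine Matrix.ext fun i j => ?_
    have := congrFun (hGs (Pi.single j 1)) i
    rw [← hSc, ← hG] at this
    exact this
  have h22 : LinearMap.toMatrix' G * B = 1 := by
    refine Matrix.ext fun i j => ?_
    have := congrFun (hGb j) i
    rw [← hG, Pi.single_apply] at this
    rw [Matrix.one_apply]
    exact this
  refine ⟨LinearMap.toMatrix' G, ?_⟩
  let e : Fin n ≃ Fin m ⊕ Fin (n - m) :=
    (finCongr (Nat.add_sub_cancel' hmn).symm).trans finSumFinEquiv.symm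
  refine Matrix.isUnit_det_of_right_inverse (B := (Matrix.fromCols S B).submatrix id e) ?_
  change (Matrix.fromRows Q (LinearMap.toMatrix' G)).submatrix e id * _ = 1
  rw [← Matrix.submatrix_mul _ _ e id e Function.bijective_id]
  rw [Matrix.fromRows_mul_fromCols, h11, h12, h21, h22, Matrix.fromBlocks_one]
  simp
end

section
/- Let F be a field with algebraic closure F̄, and let L(λ) ∈ F[λ]^{m1×n} and N(λ) ∈ F[λ]^{m2×n} be matrix polynomials with m1 + m2 = n such that L(λ0) and N(λ0) both have full row rank for every λ0 ∈ F̄ and L(λ)N(λ)ᵀ = 0. Then there exist matrix polynomials L̂(λ) ∈ F[λ]^{m2×n} and N̂(λ) ∈ F[λ]^{m1×n} such that the n×n matrix polynomial U(λ) with first m1 rows equal to L(λ) and last m2 rows equal to L̂(λ) is unimodular, and U(λ)·[N̂(λ)ᵀ | N(λ)ᵀ] = I_n (so U(λ)⁻¹ has its last m2 columns equal to N(λ)ᵀ). -/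
open Polynomial Matrix

theorem right_inv_aux (F : Type*) [Field F] (m n : ℕ)
    (A : Matrix (Fin m) (Fin n) (Polynomial F))
    (hA : ∀ x : AlgebraicClosure F, (evalMat A x).rank = m) :
    ∃ B : Matrix (Fin n) (Fin m) (Polynomial F), A * B = 1 := by
  have hs : Function.Surjective A.mulVecLin := by
    rw [← LinearMap.range_eq_top]
    by_contra hne
    obtain ⟨K, hK, hle⟩ := (eq_top_or_exists_le_coatom (LinearMap.range A.mulVecLin)).resolve_left hne
    have hsimp : IsSimpleModule (Polynomial F) ((Fin m → Polynomial F) ⧸ K) :=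
      isSimpleModule_iff_isCoatom.mpr hK
    obtain ⟨M, hM, ⟨e⟩⟩ := isSimpleModule_iff_quot_maximal.mp hsimp
    have hMb : M ≠ ⊥ := Ring.ne_bot_of_isMaximal_of_not_isField hM (Polynomial.not_isField F)
    obtain ⟨p, hp⟩ := (IsPrincipalIdealRing.principal M).principal
    have hp' : M = Ideal.span {p} := hp
    have hp0 : p ≠ 0 := by
      rintro rfl
      exact hMb (by simp [hp'])
    have hpd : p.degree ≠ 0 := by
      intro h
      apply hM.ne_top
      rw [hp', Ideal.span_singleton_eq_top]
      exact Polynomial.isUnit_iff_degree_eq_zero.mpr h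
    obtain ⟨x, hx⟩ := IsAlgClosed.exists_aeval_eq_zero (AlgebraicClosure F) p hpd
    have hker : ∀ a ∈ M, Polynomial.aeval x a = 0 := by
      intro a ha
      rw [hp', Ideal.mem_span_singleton] at ha
      obtain ⟨c, rfl⟩ := ha
      simp [hx]
    let _ : Field (Polynomial F ⧸ M) := Ideal.Quotient.field M
    let g : (Polynomial F ⧸ M) →+* AlgebraicClosure F :=
      Ideal.Quotient.lift M (Polynomial.aeval x).toRingHom hker
    have hg : ∀ (a : Polynomial F) (b : Polynomial F ⧸ M), g (a • b) = Polynomial.aeval x a * g b := by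
      intro a b
      rw [Algebra.smul_def, map_mul]
      rfl
    have hginj : Function.Injective g := g.injective
    let φ : (Fin m → Polynomial F) →ₗ[Polynomial F] (Polynomial F ⧸ M) := e.toLinearMap ∘ₗ K.mkQ
    have hφ : ∀ w, g (φ w) = ∑ i, Polynomial.aeval x (w i) * g (φ (Pi.single i 1)) := by
      intro w
      conv_lhs => rw [pi_eq_sum_univ' w]
      simp only [map_sum, map_smul, hg]
    have hφ0 : ∀ u, φ (A *ᵥ u) = 0 := by
      intro u
      have : A *ᵥ u ∈ K := hle ⟨u, rfl⟩
      simp [φ, this]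
    let v : Fin m → AlgebraicClosure F := fun i => g (φ (Pi.single i 1))
    have hv : v ᵥ* evalMat A x = 0 := by
      ext j
      have h1 := hφ (A *ᵥ Pi.single j 1)
      rw [hφ0, map_zero] at h1
      simp only [Matrix.mulVec_single_one, Matrix.col_apply] at h1
      simp only [Matrix.vecMul, dotProduct, evalMat, Matrix.of_apply, Pi.zero_apply, v]
      rw [h1]
      exact Finset.sum_congr rfl fun i _ => mul_comm _ _
    have hli : LinearIndependent (AlgebraicClosure F) (evalMat A x).row := by
      rw [linearIndependent_iff_card_eq_finrank_span, Set.finrank, ← Matrix.rank_eq_finrank_span_row, hA x,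
        Fintype.card_fin]
    have hv0 : v = 0 := Matrix.vecMul_injective_iff.mpr hli (by simpa using hv)
    apply hK.1
    rw [eq_top_iff]
    intro w _
    have h2 : g (φ w) = 0 := by
      rw [hφ]
      exact Finset.sum_eq_zero fun i _ => by
        have : g (φ (Pi.single i 1)) = 0 := congrFun hv0 i
        rw [this, mul_zero]
    have h3 : φ w = 0 := hginj (by rw [h2, map_zero])
    have h4 : K.mkQ w = 0 := e.injective (by rw [map_zero]; exact h3)
    simpa using h4
  choose f hf using fun i : Fin m => hs (Pi.single i 1)
  refine ⟨Matrix.of fun j i => f i j, ?_⟩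
  ext i j
  have := congrFun (hf j) i
  simp only [Matrix.mulVecLin_apply, Matrix.mulVec, dotProduct] at this
  simp only [Matrix.mul_apply, Matrix.of_apply, this]
  simp [Matrix.one_apply, Pi.single_apply]

/-- If `L(λ) ∈ F[λ]^{m1×n}` and `N(λ) ∈ F[λ]^{m2×n}` with `m1 + m2 = n`
have full row rank at every point of the algebraic closure of `F` and `L(λ)N(λ)ᵀ = 0`,
then there exist `L̂(λ) ∈ F[λ]^{m2×n}` and `N̂(λ) ∈ F[λ]^{m1×n}` such that
`U(λ) = [L(λ); L̂(λ)]` is unimodular and `U(λ)·[N̂(λ)ᵀ | N(λ)ᵀ] = I_n`. -/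
theorem statement_1 (F : Type*) [Field F] (m1 m2 n : ℕ) (hsum : m1 + m2 = n)
    (L : Matrix (Fin m1) (Fin n) (Polynomial F))
    (N : Matrix (Fin m2) (Fin n) (Polynomial F))
    (hL : ∀ x : AlgebraicClosure F, (evalMat L x).rank = m1)
    (hN : ∀ x : AlgebraicClosure F, (evalMat N x).rank = m2)
    (hLN : L * N.transpose = 0) :
    ∃ (Lhat : Matrix (Fin m2) (Fin n) (Polynomial F))
      (Nhat : Matrix (Fin m1) (Fin n) (Polynomial F)),
      IsUnit ((Matrix.fromRows L Lhat).submatrix id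
        (fun j : Fin m1 ⊕ Fin m2 => finCongr hsum (finSumFinEquiv j))).det ∧
      Matrix.fromRows L Lhat * Matrix.fromCols Nhat.transpose N.transpose = 1 := by
  obtain ⟨B, hB⟩ := right_inv_aux F m1 n L hL
  obtain ⟨C, hC⟩ := right_inv_aux F m2 n N hN
  have hC' : Cᵀ * Nᵀ = 1 := by rw [← Matrix.transpose_mul, hC, Matrix.transpose_one]
  have key : Matrix.fromRows L Cᵀ *
      Matrix.fromCols ((B - Nᵀ * (Cᵀ * B))ᵀ).transpose N.transpose = 1 := by
    rw [Matrix.transpose_transpose, Matrix.fromRows_mul_fromCols, Matrix.mul_sub, Matrix.mul_sub,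
      ← Matrix.mul_assoc L, ← Matrix.mul_assoc Cᵀ Nᵀ, hLN, hC', hB]
    simp
  refine ⟨Cᵀ, (B - Nᵀ * (Cᵀ * B))ᵀ, ?_, key⟩
  let e : Fin m1 ⊕ Fin m2 ≃ Fin n := finSumFinEquiv.trans (finCongr hsum)
  apply Matrix.isUnit_det_of_right_inverse
    (B := (Matrix.fromCols ((B - Nᵀ * (Cᵀ * B))ᵀ).transpose N.transpose).submatrix e id)
  have := Matrix.submatrix_mul_equiv (Matrix.fromRows L Cᵀ)
    (Matrix.fromCols ((B - Nᵀ * (Cᵀ * B))ᵀ).transpose N.transpose) id e id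
  rw [key] at this
  rw [Matrix.submatrix_id_id] at this
  exact this
end

section
/- Let 𝕂 be ℝ or ℂ, let P(λ) = Σ_{i=0}^{d} P_i λ^i ∈ 𝕂[λ]^{m×k} be a matrix polynomial of grade d (degree at most d) and let Q(λ) = Σ_{i=0}^{t} Q_i λ^i ∈ 𝕂[λ]^{k×n} be a matrix polynomial of grade t. Then ‖P(λ)Q(λ)‖_F ≤ min{√(d+1), √(t+1)} · ‖P(λ)‖_F · ‖Q(λ)‖_F. -/
open Polynomial Matrix

/-- The Frobenius norm of a matrix polynomial `P(λ) = Σ_i P_i λ^i`: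
`‖P‖_F = sqrt(Σ_i ‖P_i‖_F²)`, where the inner sum runs over all (nonzero) coefficients;
this value does not depend on the grade chosen to represent `P`. -/
noncomputable def polyFrob {𝕂 : Type*} [RCLike 𝕂] {ι κ : Type*} [Fintype ι] [Fintype κ]
    (P : Matrix ι κ (Polynomial 𝕂)) : ℝ :=
  Real.sqrt (∑ i, ∑ j, ∑ k ∈ (P i j).support, ‖(P i j).coeff k‖ ^ 2)

theorem polyFrob_sq_aux {𝕂 : Type*} [RCLike 𝕂] {ι κ : Type*} [Fintype ι] [Fintype κ]
    (P : Matrix ι κ (Polynomial 𝕂)) (N : ℕ) (h : ∀ i j, (P i j).natDegree < N) :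
    polyFrob P ^ 2 = ∑ i, ∑ j, ∑ s ∈ Finset.range N, ‖(P i j).coeff s‖ ^ 2 := by
  unfold polyFrob
  rw [Real.sq_sqrt (by positivity)]
  refine Finset.sum_congr rfl fun i _ => Finset.sum_congr rfl fun j _ => ?_
  refine Finset.sum_subset ?_ ?_
  · intro s hs
    have := Polynomial.le_natDegree_of_mem_supp s hs
    have := h i j
    simp only [Finset.mem_range]; omega
  · intro s _ hs
    rw [Polynomial.notMem_support_iff.mp hs]; simp

theorem polyFrob_nonneg_aux {𝕂 : Type*} [RCLike 𝕂] {ι κ : Type*} [Fintype ι] [Fintype κ]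
    (P : Matrix ι κ (Polynomial 𝕂)) : 0 ≤ polyFrob P := Real.sqrt_nonneg _

theorem polyFrob_transpose_aux {𝕂 : Type*} [RCLike 𝕂] {ι κ : Type*} [Fintype ι] [Fintype κ]
    (P : Matrix ι κ (Polynomial 𝕂)) : polyFrob Pᵀ = polyFrob P := by
  unfold polyFrob
  rw [Finset.sum_comm]
  rfl

theorem conv_sum_aux (N : ℕ) (A B : ℕ → ℝ) (hA : ∀ a, 0 ≤ A a) (hB : ∀ a, 0 ≤ B a) :
    ∑ s ∈ Finset.range N, ∑ x ∈ Finset.HasAntidiagonal.antidiagonal s, A x.1 * B x.2 ≤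
      (∑ a ∈ Finset.range N, A a) * (∑ b ∈ Finset.range N, B b) := by
  have h1 : ∀ s ∈ Finset.range N, ∑ x ∈ Finset.HasAntidiagonal.antidiagonal s, A x.1 * B x.2 =
      ∑ x ∈ Finset.range N ×ˢ Finset.range N, if x.1 + x.2 = s then A x.1 * B x.2 else 0 := by
    intro s hs
    rw [← Finset.sum_filter]
    refine Finset.sum_congr ?_ fun _ _ => rfl
    ext x
    simp only [Finset.mem_range] at hs
    simp only [Finset.HasAntidiagonal.mem_antidiagonal, Finset.mem_filter, Finset.mem_product, Finset.mem_range]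
    omega
  rw [Finset.sum_congr rfl h1, Finset.sum_comm, Finset.sum_mul_sum,
    ← Finset.sum_product' (Finset.range N) (Finset.range N) (fun a b => A a * B b)]
  refine Finset.sum_le_sum fun x _ => ?_
  have := mul_nonneg (hA x.1) (hB x.2)
  rw [Finset.sum_ite_eq]
  split_ifs <;> simp [this]

theorem coeff_bound_aux {𝕂 : Type*} [RCLike 𝕂] {ι κ μ : Type*} [Fintype ι] [Fintype κ]
    [Fintype μ] (d : ℕ) (P : Matrix ι κ (Polynomial 𝕂)) (Q : Matrix κ μ (Polynomial 𝕂))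
    (hP : ∀ i j, (P i j).natDegree ≤ d) (i : ι) (j : μ) (s : ℕ) :
    ‖((P * Q) i j).coeff s‖ ^ 2 ≤ ((d : ℝ) + 1) * ∑ x ∈ Finset.HasAntidiagonal.antidiagonal s,
      (∑ l, ‖(P i l).coeff x.1‖ ^ 2) * (∑ l, ‖(Q l j).coeff x.2‖ ^ 2) := by
  have h1 : ((P * Q) i j).coeff s = ∑ x ∈ Finset.HasAntidiagonal.antidiagonal s with x.1 ≤ d,
      ∑ l, (P i l).coeff x.1 * (Q l j).coeff x.2 := by
    rw [Matrix.mul_apply, Polynomial.finsetSum_coeff]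
    simp_rw [Polynomial.coeff_mul]
    rw [Finset.sum_comm, Finset.sum_filter]
    refine Finset.sum_congr rfl fun x _ => ?_
    split_ifs with hx
    · rfl
    · refine Finset.sum_eq_zero fun l _ => ?_
      rw [Polynomial.coeff_eq_zero_of_natDegree_lt (by have := hP i l; omega), zero_mul]
  have hcard : (((Finset.HasAntidiagonal.antidiagonal s).filter (fun x => x.1 ≤ d)).card : ℝ) ≤ (d : ℝ) + 1 := by
    have : ((Finset.HasAntidiagonal.antidiagonal s).filter (fun x => x.1 ≤ d)).card ≤ (Finset.range (d+1)).card := by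
      refine Finset.card_le_card_of_injOn Prod.fst ?_ ?_
      · intro x hx
        simp at hx ⊢
        omega
      · intro x hx y hy hxy
        simp at hx hy
        ext <;> omega
    rw [Finset.card_range] at this
    exact_mod_cast this
  rw [h1]
  calc _ ≤ (∑ x ∈ Finset.HasAntidiagonal.antidiagonal s with x.1 ≤ d,
      ‖∑ l, (P i l).coeff x.1 * (Q l j).coeff x.2‖) ^ 2 := by
        gcongr; exact norm_sum_le _ _
    _ ≤ _ := sq_sum_le_card_mul_sum_sq
    _ ≤ ((d : ℝ) + 1) * ∑ x ∈ Finset.HasAntidiagonal.antidiagonal s with x.1 ≤ d,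
      (∑ l, ‖(P i l).coeff x.1‖ ^ 2) * (∑ l, ‖(Q l j).coeff x.2‖ ^ 2) := by
        gcongr with x hx
        refine le_trans ?_ (Finset.sum_mul_sq_le_sq_mul_sq _ _ _)
        gcongr
        refine (norm_sum_le _ _).trans (le_of_eq ?_)
        simp
    _ ≤ _ := by
        gcongr
        exact Finset.filter_subset _ _

theorem polyFrob_mul_aux {𝕂 : Type*} [RCLike 𝕂] {ι κ μ : Type*} [Fintype ι] [Fintype κ]
    [Fintype μ] (d t : ℕ) (P : Matrix ι κ (Polynomial 𝕂)) (Q : Matrix κ μ (Polynomial 𝕂))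
    (hP : ∀ i j, (P i j).natDegree ≤ d) (hQ : ∀ i j, (Q i j).natDegree ≤ t) :
    polyFrob (P * Q) ≤ Real.sqrt ((d : ℝ) + 1) * polyFrob P * polyFrob Q := by
  have hp := polyFrob_nonneg_aux P
  have hq := polyFrob_nonneg_aux Q
  refine (sq_le_sq₀ (polyFrob_nonneg_aux _) (by positivity)).mp ?_
  rw [mul_pow, mul_pow, Real.sq_sqrt (by positivity)]
  rw [polyFrob_sq_aux P (d + t + 1) (fun i j => by have := hP i j; omega),
    polyFrob_sq_aux Q (d + t + 1) (fun i j => by have := hQ i j; omega),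
    polyFrob_sq_aux (P * Q) (d + t + 1) (fun i j => by
      rw [Matrix.mul_apply, Nat.lt_succ_iff]
      refine Polynomial.natDegree_sum_le_of_forall_le _ _ fun l _ => ?_
      exact Polynomial.natDegree_mul_le.trans (Nat.add_le_add (hP i l) (hQ l j)))]
  have key : ∀ i j, ∑ s ∈ Finset.range (d + t + 1), ‖((P * Q) i j).coeff s‖ ^ 2 ≤
      ((d : ℝ) + 1) * ((∑ l, ∑ a ∈ Finset.range (d + t + 1), ‖(P i l).coeff a‖ ^ 2) *
        (∑ l, ∑ b ∈ Finset.range (d + t + 1), ‖(Q l j).coeff b‖ ^ 2)) := by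
    intro i j
    refine (Finset.sum_le_sum fun s _ => coeff_bound_aux d P Q hP i j s).trans ?_
    rw [← Finset.mul_sum]
    gcongr
    refine (conv_sum_aux (d + t + 1) (fun a => ∑ l, ‖(P i l).coeff a‖ ^ 2)
      (fun b => ∑ l, ‖(Q l j).coeff b‖ ^ 2) (fun _ => by positivity)
      (fun _ => by positivity)).trans (le_of_eq ?_)
    congr 1 <;> exact Finset.sum_comm
  refine (Finset.sum_le_sum fun i _ => Finset.sum_le_sum fun j _ => key i j).trans (le_of_eq ?_)
  simp_rw [← Finset.mul_sum]
  rw [← Finset.sum_mul, mul_assoc]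
  congr 2
  exact Finset.sum_comm

/-- For matrix polynomials `P` of grade `d` and `Q` of grade `t`
(over `𝕂 = ℝ` or `ℂ`), one has
`‖P(λ)Q(λ)‖_F ≤ min{√(d+1), √(t+1)}·‖P(λ)‖_F·‖Q(λ)‖_F`. -/
theorem statement_2 {𝕂 : Type*} [RCLike 𝕂] {m k n : ℕ} (d t : ℕ)
    (P : Matrix (Fin m) (Fin k) (Polynomial 𝕂)) (Q : Matrix (Fin k) (Fin n) (Polynomial 𝕂))
    (hP : ∀ i j, (P i j).natDegree ≤ d) (hQ : ∀ i j, (Q i j).natDegree ≤ t) :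
    polyFrob (P * Q) ≤
      min (Real.sqrt ((d : ℝ) + 1)) (Real.sqrt ((t : ℝ) + 1)) * polyFrob P * polyFrob Q := by
  rcases min_choice (Real.sqrt ((d : ℝ) + 1)) (Real.sqrt ((t : ℝ) + 1)) with h | h
  · rw [h]
    exact polyFrob_mul_aux d t P Q hP hQ
  · rw [h]
    have := polyFrob_mul_aux t d Qᵀ Pᵀ (fun i j => hQ j i) (fun i j => hP j i)
    rw [← Matrix.transpose_mul, polyFrob_transpose_aux, polyFrob_transpose_aux,
      polyFrob_transpose_aux] at this
    linarith [mul_right_comm (Real.sqrt ((t : ℝ) + 1)) (polyFrob P) (polyFrob Q)]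
end

section
/- Let F be a field, let P(λ) ∈ F[λ]^{m×n} be a matrix polynomial, and let L(λ) be a pencil of size (t+m+s)×(s+n+t) for some integers s, t ≥ 0. Suppose there exist unimodular matrix polynomials Ũ(λ), Ṽ(λ) and matrix polynomials Z(λ) ∈ F[λ]^{t×s}, X(λ) ∈ F[λ]^{t×n}, Y(λ) ∈ F[λ]^{m×s} such that Ũ(λ)L(λ)Ṽ(λ) equals the 3×3 block matrix [[Z(λ), X(λ), I_t],[Y(λ), P(λ), 0],[I_s, 0, 0]]. Then L(λ) is a linearization of P(λ); more precisely, there exist unimodular matrix polynomials U(λ), V(λ) such that U(λ)L(λ)V(λ) = diag(I_{t+s}, P(λ)). -/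
open Matrix

/-- If a pencil `L(λ)` of size `(t+m+s)×(s+n+t)` is unimodularly equivalent to
the block anti-triangular matrix `[[Z, X, I_t],[Y, P, 0],[I_s, 0, 0]]`, then `L(λ)` is a
linearization of `P(λ)`: there exist unimodular `U(λ), V(λ)` with
`U(λ)L(λ)V(λ) = diag(I_{t+s}, P(λ))`. -/
theorem statement_3 (F : Type*) [Field F] (m n s t : ℕ)
    (P : Matrix (Fin m) (Fin n) (Polynomial F))
    (L : Matrix (Fin t ⊕ Fin m ⊕ Fin s) (Fin s ⊕ Fin n ⊕ Fin t) (Polynomial F))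
    (hLdeg : ∀ i j, (L i j).natDegree ≤ 1)
    (Zm : Matrix (Fin t) (Fin s) (Polynomial F))
    (Xm : Matrix (Fin t) (Fin n) (Polynomial F))
    (Ym : Matrix (Fin m) (Fin s) (Polynomial F))
    (Ut : Matrix (Fin t ⊕ Fin m ⊕ Fin s) (Fin t ⊕ Fin m ⊕ Fin s) (Polynomial F))
    (Vt : Matrix (Fin s ⊕ Fin n ⊕ Fin t) (Fin s ⊕ Fin n ⊕ Fin t) (Polynomial F))
    (hUt : IsUnit Ut.det) (hVt : IsUnit Vt.det)
    (hblock : Ut * L * Vt =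
      Matrix.fromBlocks Zm (Matrix.fromCols Xm 1) (Matrix.fromRows Ym 1)
        (Matrix.fromBlocks P 0 0 0)) :
    ∃ (U : Matrix (Fin t ⊕ Fin m ⊕ Fin s) (Fin t ⊕ Fin m ⊕ Fin s) (Polynomial F))
      (V : Matrix (Fin s ⊕ Fin n ⊕ Fin t) (Fin s ⊕ Fin n ⊕ Fin t) (Polynomial F)),
      IsUnit U.det ∧ IsUnit V.det ∧
      (U * L * V).submatrix
        ((Equiv.sumAssoc (Fin t) (Fin s) (Fin m)).trans
          (Equiv.sumCongr (Equiv.refl (Fin t)) (Equiv.sumComm (Fin s) (Fin m))))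
        ((Equiv.sumCongr (Equiv.sumComm (Fin t) (Fin s)) (Equiv.refl (Fin n))).trans
          ((Equiv.sumAssoc (Fin s) (Fin t) (Fin n)).trans
            (Equiv.sumCongr (Equiv.refl (Fin s)) (Equiv.sumComm (Fin t) (Fin n)))))
        = Matrix.fromBlocks 1 0 0 P := by
  refine ⟨(fromBlocks 1 (fromCols 0 (-Zm)) 0 (fromBlocks 1 (-Ym) 0 1)) * Ut,
    Vt * (fromBlocks 1 0 0 (fromBlocks 1 0 (-Xm) 1)), ?_, ?_, ?_⟩
  · simpa [det_mul, det_fromBlocks_zero₂₁] using hUt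
  · simpa [det_mul, det_fromBlocks_zero₂₁, det_fromBlocks_zero₁₂] using hVt
  · have key : (fromBlocks 1 (fromCols 0 (-Zm)) 0 (fromBlocks 1 (-Ym) 0 1)) * Ut * L *
        (Vt * (fromBlocks 1 0 0 (fromBlocks 1 0 (-Xm) 1))) =
        fromBlocks 0 (fromCols 0 1) (fromRows 0 1) (fromBlocks P 0 0 0) := by
      have h : ∀ A B, A * Ut * L * (Vt * B) = A * (Ut * L * Vt) * B := by
        intro A B
        simp only [Matrix.mul_assoc]
      rw [h, hblock]
      ext (i | i | i) (j | j | j) <;>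
      simp [fromBlocks_multiply, fromCols_mul_fromRows, fromCols_mul_fromBlocks,
        fromBlocks_mul_fromRows]
    rw [key]
    ext ((i | i) | i) ((j | j) | j) <;> simp [Matrix.one_apply]
end

section
/- Let F be a field with algebraic closure F̄. For i = 1, 2, let K_i(λ) ∈ F[λ]^{m_i×n_i} be a pencil and N_i(λ) ∈ F[λ]^{(n_i−m_i)×n_i} a matrix polynomial such that K_i(λ0) and N_i(λ0) have full row rank for every λ0 ∈ F̄ and K_i(λ)N_i(λ)ᵀ = 0 (these conditions hold in particular whenever K_i and N_i are dual minimal bases). Let M(λ) be any pencil of size n_2×n_1 and define the block pencil L(λ) := [[M(λ), K_2(λ)ᵀ],[K_1(λ), 0]]. Then L(λ) is a linearization of Q(λ) := N_2(λ)M(λ)N_1(λ)ᵀ; more precisely, there exist unimodular matrix polynomials U(λ), V(λ) with U(λ)L(λ)V(λ) = diag(I_{m_1+m_2}, Q(λ)). -/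
open Polynomial Matrix

/-- `L` is a linearization of `P` with identity block of size `s`: there are unimodular
matrix polynomials `U, V` with `U·L·V = diag(I_s, P)` (up to a bijective relabelling of the
row and column indices of `L`). -/
def IsLinearizationWith {F : Type*} [Field F] {R C ι κ : Type*}
    [Fintype R] [Fintype C] [DecidableEq R] [DecidableEq C]
    (s : ℕ) (L : Matrix R C (Polynomial F)) (P : Matrix ι κ (Polynomial F)) : Prop :=
  ∃ (er : R ≃ (Fin s ⊕ ι)) (ec : C ≃ (Fin s ⊕ κ))
    (U : Matrix R R (Polynomial F)) (V : Matrix C C (Polynomial F)),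
    IsUnit U.det ∧ IsUnit V.det ∧
    (U * L * V).submatrix er.symm ec.symm = Matrix.fromBlocks 1 0 0 P

/-- `L` is a linearization of `P`: `U·L·V = diag(I_s, P)` for some `s ≥ 0` and
unimodular `U, V`. -/
def IsLinearization {F : Type*} [Field F] {R C ι κ : Type*}
    [Fintype R] [Fintype C] [DecidableEq R] [DecidableEq C]
    (L : Matrix R C (Polynomial F)) (P : Matrix ι κ (Polynomial F)) : Prop :=
  ∃ s : ℕ, IsLinearizationWith s L P

/-- The grade-`d` reversal `rev_d P(λ) := λ^d·P(1/λ)` of a matrix polynomial,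
computed entrywise by `Polynomial.reflect`. -/
noncomputable def revMat {R : Type*} [CommRing R] {ι κ : Type*} (d : ℕ)
    (P : Matrix ι κ (Polynomial R)) : Matrix ι κ (Polynomial R) :=
  Matrix.of fun i j => (P i j).reflect d

theorem exists_minor {k : Type*} [Field k] {m n : ℕ} (P : Matrix (Fin m) (Fin n) k)
    (h : P.rank = m) : ∃ s : Fin m → Fin n, (P.submatrix id s).det ≠ 0 := by
  obtain ⟨κ, a, ha, hs, hl⟩ := exists_linearIndependent' k P.col
  have : Finite κ := Finite.of_injective a ha
  have : Fintype κ := Fintype.ofFinite κ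
  have hc : Fintype.card κ = m := by
    rw [← finrank_span_eq_card hl, hs, ← Matrix.rank_eq_finrank_span_cols, h]
  let e : Fin m ≃ κ := (Fintype.equivFinOfCardEq hc).symm
  refine ⟨a ∘ e, ?_⟩
  have h2 : LinearIndependent k (P.submatrix id (a ∘ e)).col := hl.comp e e.injective
  rw [Matrix.linearIndependent_cols_iff_isUnit, Matrix.isUnit_iff_isUnit_det] at h2
  exact h2.ne_zero

theorem exists_right_inv {F : Type*} [Field F] {m n : ℕ} (P : Matrix (Fin m) (Fin n) F[X])
    (h : ∀ x : AlgebraicClosure F, (evalMat P x).rank = m) :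
    ∃ A : Matrix (Fin n) (Fin m) F[X], P * A = 1 := by
  let I : Ideal F[X] :=
    { carrier := {d | ∃ A : Matrix (Fin n) (Fin m) F[X], P * A = d • (1 : Matrix _ _ F[X])}
      add_mem' := by
        rintro a b ⟨A, hA⟩ ⟨B, hB⟩
        exact ⟨A + B, by rw [Matrix.mul_add, hA, hB, add_smul]⟩
      zero_mem' := ⟨0, by simp⟩
      smul_mem' := by
        rintro c a ⟨A, hA⟩
        exact ⟨c • A, by rw [Matrix.mul_smul, hA, smul_smul, smul_eq_mul]⟩ }
  have hminor : ∀ s : Fin m → Fin n, (P.submatrix id s).det ∈ I := by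
    intro s
    refine ⟨(1 : Matrix (Fin n) (Fin n) F[X]).submatrix id s * (P.submatrix id s).adjugate, ?_⟩
    rw [← Matrix.mul_assoc, ← Matrix.mul_adjugate]
    congr 1
    ext i j
    simp [Matrix.mul_apply, Matrix.one_apply]
  suffices hI : (1 : F[X]) ∈ I by
    obtain ⟨A, hA⟩ := hI
    exact ⟨A, by simpa using hA⟩
  rw [← Ideal.eq_top_iff_one]
  by_contra hne
  have hgen := Ideal.span_singleton_generator I
  set g := Submodule.IsPrincipal.generator I with hg
  have hgu : ¬ IsUnit g := fun hu => hne (by rw [← hgen]; exact Ideal.span_singleton_eq_top.2 hu)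
  obtain ⟨x, hx⟩ : ∃ x : AlgebraicClosure F, aeval x g = 0 := by
    by_cases h0 : g = 0
    · exact ⟨0, by simp [h0]⟩
    · refine IsAlgClosed.exists_aeval_eq_zero _ g ?_
      intro hd
      exact hgu (Polynomial.isUnit_iff_degree_eq_zero.2 hd)
  obtain ⟨s, hs⟩ := exists_minor _ (h x)
  apply hs
  have h3 : ((evalMat P x).submatrix id s).det = aeval x (P.submatrix id s).det := by
    rw [AlgHom.map_det]
    rfl
  rw [h3]
  have h4 := hminor s
  rw [← hgen, Ideal.mem_span_singleton] at h4
  obtain ⟨c, hc⟩ := h4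
  rw [hc, map_mul, hx, zero_mul]

theorem exists_completion {F : Type*} [Field F] {m n r : ℕ} (K : Matrix (Fin m) (Fin n) F[X])
    (N : Matrix (Fin r) (Fin n) F[X])
    (hK : ∀ x : AlgebraicClosure F, (evalMat K x).rank = m)
    (hN : ∀ x : AlgebraicClosure F, (evalMat N x).rank = r)
    (hKN : K * Nᵀ = 0) :
    ∃ (A : Matrix (Fin n) (Fin m) F[X]) (C : Matrix (Fin r) (Fin n) F[X]),
      K * A = 1 ∧ C * A = 0 ∧ C * Nᵀ = 1 := by
  obtain ⟨A, hA⟩ := exists_right_inv K hK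
  obtain ⟨B, hB⟩ := exists_right_inv N hN
  refine ⟨A, Bᵀ - Bᵀ * A * K, hA, ?_, ?_⟩
  · rw [Matrix.sub_mul, Matrix.mul_assoc _ K, hA, Matrix.mul_one, sub_self]
  · rw [Matrix.sub_mul, Matrix.mul_assoc _ K, hKN, Matrix.mul_zero, sub_zero,
      ← Matrix.transpose_mul, hB, Matrix.transpose_one]

theorem lin_of_rect {F : Type*} [Field F] {R C S ι κ : Type*} {s : ℕ}
    [Fintype R] [Fintype C] [DecidableEq R] [DecidableEq C] [Fintype S] [DecidableEq S]
    [Fintype ι] [Fintype κ] [DecidableEq ι] [DecidableEq κ]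
    (e : S ≃ Fin s) (L : Matrix R C F[X]) (P : Matrix ι κ F[X])
    (er : R ≃ S ⊕ ι) (ec : C ≃ S ⊕ κ)
    (U : Matrix (S ⊕ ι) R F[X]) (U' : Matrix R (S ⊕ ι) F[X])
    (V : Matrix C (S ⊕ κ) F[X]) (V' : Matrix (S ⊕ κ) C F[X])
    (hU : U * U' = 1) (hV : V' * V = 1) (h : U * L * V = fromBlocks 1 0 0 P) :
    IsLinearizationWith s L P := by
  refine ⟨er.trans (e.sumCongr (Equiv.refl _)), ec.trans (e.sumCongr (Equiv.refl _)),
    U.submatrix er id, V.submatrix id ec, ?_, ?_, ?_⟩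
  · have h1 : U.submatrix er id * U'.submatrix id er = 1 := by
      rw [← Matrix.submatrix_mul _ _ _ _ _ Function.bijective_id, hU, Matrix.submatrix_one_equiv]
    exact Matrix.isUnit_det_of_right_inverse h1
  · have h1 : V'.submatrix ec id * V.submatrix id ec = 1 := by
      rw [← Matrix.submatrix_mul _ _ _ _ _ Function.bijective_id, hV, Matrix.submatrix_one_equiv]
    exact Matrix.isUnit_det_of_left_inverse h1
  · have h1 : U.submatrix er id * L * V.submatrix id ec = (U * L * V).submatrix er ec := by
      rfl
    rw [h1, h]
    ext i j
    rcases i with i | i <;> rcases j with j | j <;> simp [Matrix.one_apply]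

/-- For `i = 1,2` let `K_i(λ)` be a pencil and `N_i(λ)` a matrix polynomial
with `K_i(λ0), N_i(λ0)` of full row rank for all `λ0` in the algebraic closure and
`K_i(λ)N_i(λ)ᵀ = 0`. Then the block pencil `L(λ) = [[M(λ), K_2(λ)ᵀ],[K_1(λ), 0]]` is a
linearization of `Q(λ) = N_2(λ)M(λ)N_1(λ)ᵀ` with `U(λ)L(λ)V(λ) = diag(I_{m1+m2}, Q(λ))`. -/
theorem statement_4 (F : Type*) [Field F] (m1 n1 m2 n2 : ℕ)
    (h1 : m1 ≤ n1) (h2 : m2 ≤ n2)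
    (K1 : Matrix (Fin m1) (Fin n1) (Polynomial F))
    (N1 : Matrix (Fin (n1 - m1)) (Fin n1) (Polynomial F))
    (K2 : Matrix (Fin m2) (Fin n2) (Polynomial F))
    (N2 : Matrix (Fin (n2 - m2)) (Fin n2) (Polynomial F))
    (hK1deg : ∀ i j, (K1 i j).natDegree ≤ 1)
    (hK2deg : ∀ i j, (K2 i j).natDegree ≤ 1)
    (hK1 : ∀ x : AlgebraicClosure F, (evalMat K1 x).rank = m1)
    (hN1 : ∀ x : AlgebraicClosure F, (evalMat N1 x).rank = n1 - m1)
    (hK2 : ∀ x : AlgebraicClosure F, (evalMat K2 x).rank = m2)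
    (hN2 : ∀ x : AlgebraicClosure F, (evalMat N2 x).rank = n2 - m2)
    (hKN1 : K1 * N1.transpose = 0) (hKN2 : K2 * N2.transpose = 0)
    (M : Matrix (Fin n2) (Fin n1) (Polynomial F))
    (hM : ∀ i j, (M i j).natDegree ≤ 1) :
    IsLinearizationWith (m1 + m2) (Matrix.fromBlocks M K2.transpose K1 0)
      (N2 * M * N1.transpose) := by
  obtain ⟨A1, C1, hA1, hCA1, hCN1⟩ := exists_completion K1 N1 hK1 hN1 hKN1
  obtain ⟨A2, C2, hA2, hCA2, hCN2⟩ := exists_completion K2 N2 hK2 hN2 hKN2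
  have hA2' : A2ᵀ * K2ᵀ = 1 := by rw [← Matrix.transpose_mul, hA2, Matrix.transpose_one]
  have hCA2' : A2ᵀ * C2ᵀ = 0 := by rw [← Matrix.transpose_mul, hCA2, Matrix.transpose_zero]
  have hCN2' : N2 * C2ᵀ = 1 := by
    rw [← Matrix.transpose_one, ← hCN2, Matrix.transpose_mul, Matrix.transpose_transpose]
  have hKN2' : N2 * K2ᵀ = 0 := by
    rw [← Matrix.transpose_zero, ← hKN2, Matrix.transpose_mul, Matrix.transpose_transpose]
  have er : Fin n2 ⊕ Fin m1 ≃ (Fin m1 ⊕ Fin m2) ⊕ Fin (n2 - m2) :=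
    Fintype.equivOfCardEq (by simp; omega)
  have ec : Fin n1 ⊕ Fin m2 ≃ (Fin m1 ⊕ Fin m2) ⊕ Fin (n1 - m1) :=
    Fintype.equivOfCardEq (by simp; omega)
  refine lin_of_rect finSumFinEquiv _ _ er ec
    (fromRows (fromRows (fromCols 0 1) (fromCols A2ᵀ (-(A2ᵀ * (M * A1)))))
      (fromCols N2 (-(N2 * (M * A1)))))
    (fromCols (fromCols (fromRows (M * A1) 1) (fromRows K2ᵀ 0)) (fromRows C2ᵀ 0))
    (fromCols (fromCols (fromRows A1 0) (fromRows 0 1)) (fromRows N1ᵀ (-(A2ᵀ * (M * N1ᵀ)))))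
    (fromRows (fromRows (fromCols K1 0) (fromCols (A2ᵀ * (M * (N1ᵀ * C1))) 1)) (fromCols C1 0))
    ?_ ?_ ?_
  · simp only [fromRows_mul, mul_fromCols, fromCols_mul_fromRows, hA2', hCA2', hCN2', hKN2']
    ext i j
    rcases i with (i | i) | i <;> rcases j with (j | j) | j <;> simp [Matrix.one_apply]
  · simp only [fromRows_mul, mul_fromCols, fromCols_mul_fromRows, Matrix.mul_assoc, hA1, hCA1,
      hCN1, hKN1]
    ext i j
    rcases i with (i | i) | i <;> rcases j with (j | j) | j <;> simp [Matrix.one_apply]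
  · simp only [fromRows_mul, mul_fromCols, fromCols_mul_fromRows, fromCols_mul_fromBlocks,
      Matrix.add_mul, Matrix.neg_mul,
      Matrix.mul_assoc, hA1, hCA1, hCN1, hKN1, hA2', hKN2']
    ext i j
    rcases i with (i | i) | i <;> rcases j with (j | j) | j <;> simp [Matrix.one_apply]
end

section
/- Let F be a field with algebraic closure F̄. For i = 1, 2, let K_i(λ) = λK_i^{(1)} + K_i^{(0)} ∈ F[λ]^{m_i×n_i} be a pencil whose leading coefficient K_i^{(1)} has full row rank, and let N_i(λ) = Σ_{j=0}^{ℓ_i} N_i^{(j)} λ^j ∈ F[λ]^{(n_i−m_i)×n_i} be a matrix polynomial of grade ℓ_i whose leading coefficient N_i^{(ℓ_i)} has full row rank; assume K_i(λ0) and N_i(λ0) have full row rank for every λ0 ∈ F̄ and K_i(λ)N_i(λ)ᵀ = 0 (i.e., K_i and N_i are dual minimal bases with all row degrees of K_i equal to 1 and all row degrees of N_i equal to ℓ_i). Let M(λ) be any pencil of size n_2×n_1, set L(λ) := [[M(λ), K_2(λ)ᵀ],[K_1(λ), 0]] and Q(λ) := N_2(λ)M(λ)N_1(λ)ᵀ.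 Then rev_1 L(λ) := λ·L(1/λ) is a linearization of rev_{1+ℓ_1+ℓ_2} Q(λ) := λ^{1+ℓ_1+ℓ_2}·Q(1/λ); together with the linearization property of L itself, this says L(λ) is a strong linearization of Q(λ) regarded as a polynomial of grade 1+ℓ_1+ℓ_2. -/
open Polynomial Matrix

lemma rinv_of_rank {k : Type*} [Field k] {m n : ℕ} (A : Matrix (Fin m) (Fin n) k)
    (h : A.rank = m) : ∃ B : Matrix (Fin n) (Fin m) k, A * B = 1 := by
  rw [← Matrix.mulVec_surjective_iff_exists_right_inverse]
  have : LinearMap.range A.mulVecLin = ⊤ := by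
    apply Submodule.eq_top_of_finrank_eq
    rw [← Matrix.rank, h]; simp
  exact LinearMap.range_eq_top.mp this

lemma evalMat_rinv {F : Type*} [Field F] {A : Type*} [CommRing A] [Algebra F A] {m n : ℕ}
    (x : A) (K : Matrix (Fin m) (Fin n) F[X]) (c : A) (d : A) (hc : c * d = 1)
    (K' : Matrix (Fin m) (Fin n) A) (h : ∃ B : Matrix (Fin n) (Fin m) A, K' * B = 1) (e : evalMat K x = c • K') :
    ∃ B : Matrix (Fin n) (Fin m) A, evalMat K x * B = 1 := by
  obtain ⟨B, hB⟩ := h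
  refine ⟨d • B, ?_⟩
  rw [e, Matrix.smul_mul, Matrix.mul_smul, hB, smul_smul, hc, one_smul]

lemma rev_rinv {F : Type*} [Field F] {m n d : ℕ} (K : Matrix (Fin m) (Fin n) F[X])
    (hdeg : ∀ i j, (K i j).natDegree ≤ d)
    (hlead : (Matrix.of fun i j => (K i j).coeff d : Matrix (Fin m) (Fin n) F).rank = m)
    (hK : ∀ x : AlgebraicClosure F, (evalMat K x).rank = m) (x : AlgebraicClosure F) :
    ∃ B : Matrix (Fin n) (Fin m) (AlgebraicClosure F), evalMat (revMat d K) x * B = 1 := by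
  by_cases hx : x = 0
  · subst hx
    obtain ⟨B, hB⟩ := rinv_of_rank _ hlead
    refine ⟨B.map (algebraMap F _), ?_⟩
    have e : evalMat (revMat d K) (0 : AlgebraicClosure F) =
        (Matrix.of fun i j => (K i j).coeff d : Matrix (Fin m) (Fin n) F).map
          (algebraMap F (AlgebraicClosure F)) := by
      ext i j
      simp [evalMat, revMat, Polynomial.aeval_def, Polynomial.eval₂_at_zero,
        Polynomial.coeff_reflect]
    rw [e, ← Matrix.map_mul, hB]
    simp
  · obtain ⟨B, hB⟩ := rinv_of_rank _ (hK x⁻¹)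
    refine evalMat_rinv x (revMat d K) (x ^ d) (x⁻¹ ^ d) ?_ _ ⟨B, hB⟩ ?_
    · rw [← mul_pow, mul_inv_cancel₀ hx, one_pow]
    · ext i j
      letI : Invertible x⁻¹ := invertibleOfNonzero (inv_ne_zero hx)
      have := Polynomial.eval₂_reflect_mul_pow (algebraMap F (AlgebraicClosure F)) x⁻¹ d
        (K i j) (hdeg i j)
      simp only [evalMat, revMat, Matrix.smul_apply, Matrix.of_apply, Polynomial.aeval_def,
        smul_eq_mul]
      rw [← this, invOf_eq_inv, inv_inv, mul_comm, mul_assoc, ← mul_pow, inv_mul_cancel₀ hx]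
      simp

lemma poly_rinv {F : Type*} [Field F] {m n : ℕ} (K : Matrix (Fin m) (Fin n) F[X])
    (h : ∀ x : AlgebraicClosure F, ∃ B : Matrix (Fin n) (Fin m) (AlgebraicClosure F), evalMat K x * B = 1) : ∃ B : Matrix (Fin n) (Fin m) F[X], K * B = 1 := by
  rw [← Matrix.mulVec_surjective_iff_exists_right_inverse]
  suffices hs : LinearMap.range K.mulVecLin = ⊤ from LinearMap.range_eq_top.mp hs
  rcases eq_top_or_exists_le_coatom (LinearMap.range K.mulVecLin) with h0 | ⟨N, hN, hle⟩
  · exact h0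
  exfalso
  have hsimp := isSimpleModule_iff_isCoatom.mpr hN
  obtain ⟨I, hI, ⟨e⟩⟩ := isSimpleModule_iff_quot_maximal.mp hsimp
  letI := Ideal.Quotient.field I
  haveI : Module.Finite F (F[X] ⧸ I) := finite_of_finite_type_of_isJacobsonRing F (F[X] ⧸ I)
  let f : (F[X] ⧸ I) →ₐ[F] AlgebraicClosure F := IsAlgClosed.lift
  let g : F[X] →ₐ[F] AlgebraicClosure F := f.comp (Ideal.Quotient.mkₐ F I)
  let φ : (Fin m → F[X]) →ₗ[F[X]] (F[X] ⧸ I) := e.toLinearMap ∘ₗ N.mkQ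
  obtain ⟨B, hB⟩ := h (g X)
  have hg : ∀ p, aeval (g X) p = g p := fun p => by
    rw [Polynomial.aeval_algHom_apply]; simp
  let v : Fin m → AlgebraicClosure F := fun i => f (φ (Pi.single i 1))
  have key : ∀ w : Fin m → F[X], f (φ w) = ∑ i, v i * g (w i) := by
    intro w
    conv_lhs => rw [pi_eq_sum_univ' w]
    rw [map_sum, map_sum]
    refine Finset.sum_congr rfl fun i _ => ?_
    rw [map_smul, Algebra.smul_def, map_mul, mul_comm]
    rfl
  have hv : v ᵥ* evalMat K (g X) = 0 := by
    ext j
    have h1 : φ (K.mulVecLin (Pi.single j 1)) = 0 := by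
      have : N.mkQ (K.mulVecLin (Pi.single j 1)) = 0 :=
        (Submodule.Quotient.mk_eq_zero N).mpr (hle ⟨_, rfl⟩)
      simp only [φ, LinearMap.comp_apply, this, map_zero]
    have h2 := key (K.mulVecLin (Pi.single j 1))
    rw [h1, map_zero] at h2
    simp only [Matrix.vecMul, dotProduct, evalMat, Matrix.of_apply, hg, Pi.zero_apply]
    rw [h2]
    simp
  have hv0 : v = 0 := by
    have := congrArg (· ᵥ* B) hv
    simpa [Matrix.vecMul_vecMul, hB] using this
  apply hN.1
  rw [eq_top_iff]
  intro w _
  have h3 := key w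
  simp only [hv0, Pi.zero_apply, zero_mul, Finset.sum_const_zero] at h3
  have h4 : φ w = 0 := f.toRingHom.injective (by simpa using h3)
  have h5 : N.mkQ w = 0 := e.injective (by simpa [φ] using h4)
  simpa using h5

lemma exists_compl {R : Type*} [CommRing R] {a b c : Type*} [Fintype a] [Fintype b] [Fintype c]
    [DecidableEq a] [DecidableEq c] (K : Matrix a b R) (N : Matrix c b R) (hKN : K * Nᵀ = 0)
    (hK : ∃ A : Matrix b a R, K * A = 1) (hN : ∃ B : Matrix b c R, N * B = 1) :
    ∃ (A : Matrix b a R) (B : Matrix b c R), K * A = 1 ∧ N * B = 1 ∧ Aᵀ * B = 0 ∧ Bᵀ * A = 0 := by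
  obtain ⟨A, hA⟩ := hK
  obtain ⟨B, hB⟩ := hN
  have hNK : N * Kᵀ = 0 := by simpa using congrArg Matrix.transpose hKN
  have hA' : Aᵀ * Kᵀ = 1 := by simpa using congrArg Matrix.transpose hA
  have h0 : Aᵀ * (B - Kᵀ * (Aᵀ * B)) = 0 := by
    rw [Matrix.mul_sub, ← Matrix.mul_assoc, hA', Matrix.one_mul, sub_self]
  refine ⟨A, B - Kᵀ * (Aᵀ * B), hA, ?_, h0, ?_⟩
  · rw [Matrix.mul_sub, hB, ← Matrix.mul_assoc, hNK, Matrix.zero_mul, sub_zero]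
  · simpa using congrArg Matrix.transpose h0

lemma lin_of_factor {F : Type*} [Field F] {R C ι κ : Type*} {s : ℕ}
    [Fintype R] [Fintype C] [DecidableEq R] [DecidableEq C]
    [Fintype ι] [Fintype κ] [DecidableEq ι] [DecidableEq κ]
    (L : Matrix R C F[X]) (P : Matrix ι κ F[X])
    (er : R ≃ (Fin s ⊕ ι)) (ec : C ≃ (Fin s ⊕ κ))
    (U : Matrix (Fin s ⊕ ι) R F[X]) (U' : Matrix R (Fin s ⊕ ι) F[X])
    (V : Matrix C (Fin s ⊕ κ) F[X]) (V' : Matrix (Fin s ⊕ κ) C F[X])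
    (hU : U * U' = 1) (hV : V' * V = 1) (h : U * L * V = Matrix.fromBlocks 1 0 0 P) :
    IsLinearization L P := by
  refine ⟨s, er, ec, U.submatrix er id, V.submatrix id ec, ?_, ?_, ?_⟩
  · apply Matrix.isUnit_det_of_right_inverse (B := U'.submatrix id er)
    refine (Matrix.submatrix_mul_equiv U U' er (Equiv.refl R) er).trans ?_
    rw [hU]
    simp
  · apply Matrix.isUnit_det_of_left_inverse (B := V'.submatrix ec id)
    refine (Matrix.submatrix_mul_equiv V' V ec (Equiv.refl C) ec).trans ?_
    rw [hV]
    simp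
  · rw [← h]
    ext i j
    simp [Matrix.mul_apply]

lemma block_lin {F : Type*} [Field F] {m1 m2 : ℕ} {b1 b2 c1 c2 : Type*}
    [Fintype b1] [Fintype b2] [Fintype c1] [Fintype c2]
    [DecidableEq b1] [DecidableEq b2] [DecidableEq c1] [DecidableEq c2]
    (e1 : b1 ≃ Fin m1 ⊕ c1) (e2 : b2 ≃ Fin m2 ⊕ c2)
    (K1 : Matrix (Fin m1) b1 F[X]) (N1 : Matrix c1 b1 F[X])
    (K2 : Matrix (Fin m2) b2 F[X]) (N2 : Matrix c2 b2 F[X])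
    (hKN1 : K1 * N1ᵀ = 0) (hKN2 : K2 * N2ᵀ = 0)
    (hK1 : ∃ A : Matrix b1 (Fin m1) F[X], K1 * A = 1) (hN1 : ∃ B : Matrix b1 c1 F[X], N1 * B = 1)
    (hK2 : ∃ A : Matrix b2 (Fin m2) F[X], K2 * A = 1) (hN2 : ∃ B : Matrix b2 c2 F[X], N2 * B = 1) (M : Matrix b2 b1 F[X]) :
    IsLinearization (Matrix.fromBlocks M K2ᵀ K1 0) (N2 * M * N1ᵀ) := by
  obtain ⟨A1, B1, hA1, hB1, hAB1, hBA1⟩ := exists_compl K1 N1 hKN1 hK1 hN1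
  obtain ⟨A2, B2, hA2, hB2, hAB2, hBA2⟩ := exists_compl K2 N2 hKN2 hK2 hN2
  have hNK2 : N2 * K2ᵀ = 0 := by simpa using congrArg Matrix.transpose hKN2
  have hA2' : A2ᵀ * K2ᵀ = 1 := by simpa using congrArg Matrix.transpose hA2
  have hB1' : B1ᵀ * N1ᵀ = 1 := by simpa using congrArg Matrix.transpose hB1
  let E : Fin m2 ⊕ Fin m1 ≃ Fin (m2 + m1) := finSumFinEquiv
  let sr : (Fin m2 ⊕ Fin m1) ⊕ c2 ≃ Fin (m2 + m1) ⊕ c2 := Equiv.sumCongr E (Equiv.refl _)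
  let sc : (Fin m2 ⊕ Fin m1) ⊕ c1 ≃ Fin (m2 + m1) ⊕ c1 := Equiv.sumCongr E (Equiv.refl _)
  let er : b2 ⊕ Fin m1 ≃ (Fin m2 ⊕ Fin m1) ⊕ c2 :=
    (Equiv.sumCongr e2 (Equiv.refl _)).trans
      ((Equiv.sumAssoc _ _ _).trans ((Equiv.sumCongr (Equiv.refl _) (Equiv.sumComm _ _)).trans
        (Equiv.sumAssoc _ _ _).symm))
  let ec : b1 ⊕ Fin m2 ≃ (Fin m2 ⊕ Fin m1) ⊕ c1 :=
    (Equiv.sumComm _ _).trans ((Equiv.sumCongr (Equiv.refl _) e1).trans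
      (Equiv.sumAssoc _ _ _).symm)
  let U := fromRows (fromBlocks A2ᵀ 0 0 (1 : Matrix (Fin m1) (Fin m1) F[X]))
    (fromCols N2 (-(N2 * M * A1)))
  let U' := fromCols (fromBlocks K2ᵀ (B2 * (N2 * M * A1)) 0 (1 : Matrix (Fin m1) (Fin m1) F[X]))
    (fromRows B2 0)
  let V := fromCols (fromBlocks 0 A1 (1 : Matrix (Fin m2) (Fin m2) F[X]) (-(A2ᵀ * M * A1)))
    (fromRows N1ᵀ (-(A2ᵀ * M * N1ᵀ)))
  let V' := fromRows (fromBlocks (A2ᵀ * M) (1 : Matrix (Fin m2) (Fin m2) F[X]) K1 0)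
    (fromCols B1ᵀ 0)
  have hU : U * U' = 1 := by
    simp only [U, U', fromRows_mul_fromCols, fromBlocks_multiply, fromCols_mul_fromBlocks,
      fromBlocks_mul_fromRows, fromCols_mul_fromRows]
    simp [hA2', hNK2, hB2, hAB2, ← Matrix.mul_assoc]
  have hV : V' * V = 1 := by
    simp only [V, V', fromRows_mul_fromCols, fromBlocks_multiply, fromCols_mul_fromBlocks,
      fromBlocks_mul_fromRows, fromCols_mul_fromRows]
    simp [hA1, hKN1, hB1', hBA1, ← Matrix.mul_assoc]
  have hL : U * fromBlocks M K2ᵀ K1 0 * V = fromBlocks 1 0 0 (N2 * M * N1ᵀ) := by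
    simp only [U, V, fromRows_mul, fromRows_mul_fromCols, fromBlocks_multiply,
      fromCols_mul_fromBlocks, fromBlocks_mul_fromRows, fromCols_mul_fromRows]
    simp [hA1, hKN1, hA2', hNK2, Matrix.add_mul, Matrix.mul_assoc, fromBlocks_multiply,
      fromCols_mul_fromBlocks, fromBlocks_mul_fromRows, fromCols_mul_fromRows]
  refine lin_of_factor _ _ (er.trans sr) (ec.trans sc) (U.submatrix sr.symm id)
    (U'.submatrix id sr.symm) (V.submatrix id sc.symm) (V'.submatrix sc.symm id) ?_ ?_ ?_
  · refine (Matrix.submatrix_mul_equiv U U' sr.symm (Equiv.refl _) sr.symm).trans ?_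
    rw [hU]
    simp
  · refine (Matrix.submatrix_mul_equiv V' V sc.symm (Equiv.refl _) sc.symm).trans ?_
    rw [hV]
    simp
  · have : U.submatrix sr.symm id * fromBlocks M K2ᵀ K1 0 * V.submatrix id sc.symm =
        (U * fromBlocks M K2ᵀ K1 0 * V).submatrix sr.symm sc.symm := by
      ext i j
      simp [Matrix.mul_apply]
    rw [this, hL]
    ext i j
    rcases i with i | i <;> rcases j with j | j <;>
      simp [sr, sc, Matrix.one_apply]

lemma revMat_mul {F : Type*} [Field F] {a b c : Type*} [Fintype b] {d e : ℕ}
    (A : Matrix a b F[X]) (B : Matrix b c F[X])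
    (hA : ∀ i j, (A i j).natDegree ≤ d) (hB : ∀ i j, (B i j).natDegree ≤ e) :
    revMat (d + e) (A * B) = revMat d A * revMat e B := by
  ext1 i j
  simp only [revMat, Matrix.of_apply, Matrix.mul_apply]
  have : ∀ f : b → F[X], reflect (d + e) (∑ k, f k) = ∑ k, reflect (d + e) (f k) := fun f =>
    map_sum (AddMonoidHom.mk' (reflect (d + e)) fun p q => reflect_add p q _) f _
  rw [this]
  exact Finset.sum_congr rfl fun k _ => reflect_mul _ _ (hA i k) (hB k j)

lemma natDegree_mul_le' {F : Type*} [Field F] {a b c : Type*} [Fintype b] {d e : ℕ}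
    (A : Matrix a b F[X]) (B : Matrix b c F[X])
    (hA : ∀ i j, (A i j).natDegree ≤ d) (hB : ∀ i j, (B i j).natDegree ≤ e) (i : a) (j : c) :
    ((A * B) i j).natDegree ≤ d + e := by
  rw [Matrix.mul_apply]
  exact natDegree_sum_le_of_forall_le _ _ fun k _ =>
    natDegree_mul_le.trans (add_le_add (hA i k) (hB k j))

/-- With `K_i, N_i` dual minimal bases as in Statement 4, where in addition the
leading coefficients `K_i^{(1)}` (of the grade-1 pencils `K_i`) and `N_i^{(ℓ_i)}` (of the
grade-`ℓ_i` polynomials `N_i`) have full row rank, the reversal `rev_1 L(λ) = λL(1/λ)` of the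
block pencil `L(λ) = [[M(λ), K_2(λ)ᵀ],[K_1(λ), 0]]` is a linearization of
`rev_{1+ℓ1+ℓ2} Q(λ) = λ^{1+ℓ1+ℓ2} Q(1/λ)` where `Q(λ) = N_2(λ)M(λ)N_1(λ)ᵀ`. -/
theorem statement_5 (F : Type*) [Field F] (m1 n1 m2 n2 ℓ1 ℓ2 : ℕ)
    (h1 : m1 ≤ n1) (h2 : m2 ≤ n2)
    (K1 : Matrix (Fin m1) (Fin n1) (Polynomial F))
    (N1 : Matrix (Fin (n1 - m1)) (Fin n1) (Polynomial F))
    (K2 : Matrix (Fin m2) (Fin n2) (Polynomial F))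
    (N2 : Matrix (Fin (n2 - m2)) (Fin n2) (Polynomial F))
    (hK1deg : ∀ i j, (K1 i j).natDegree ≤ 1)
    (hK2deg : ∀ i j, (K2 i j).natDegree ≤ 1)
    (hN1deg : ∀ i j, (N1 i j).natDegree ≤ ℓ1)
    (hN2deg : ∀ i j, (N2 i j).natDegree ≤ ℓ2)
    (hK1lead : (Matrix.of fun i j => (K1 i j).coeff 1 : Matrix (Fin m1) (Fin n1) F).rank = m1)
    (hK2lead : (Matrix.of fun i j => (K2 i j).coeff 1 : Matrix (Fin m2) (Fin n2) F).rank = m2)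
    (hN1lead : (Matrix.of fun i j => (N1 i j).coeff ℓ1 :
        Matrix (Fin (n1 - m1)) (Fin n1) F).rank = n1 - m1)
    (hN2lead : (Matrix.of fun i j => (N2 i j).coeff ℓ2 :
        Matrix (Fin (n2 - m2)) (Fin n2) F).rank = n2 - m2)
    (hK1 : ∀ x : AlgebraicClosure F, (evalMat K1 x).rank = m1)
    (hN1 : ∀ x : AlgebraicClosure F, (evalMat N1 x).rank = n1 - m1)
    (hK2 : ∀ x : AlgebraicClosure F, (evalMat K2 x).rank = m2)
    (hN2 : ∀ x : AlgebraicClosure F, (evalMat N2 x).rank = n2 - m2)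
    (hKN1 : K1 * N1.transpose = 0) (hKN2 : K2 * N2.transpose = 0)
    (M : Matrix (Fin n2) (Fin n1) (Polynomial F))
    (hM : ∀ i j, (M i j).natDegree ≤ 1) :
    IsLinearization (revMat 1 (Matrix.fromBlocks M K2.transpose K1 0))
      (revMat (1 + ℓ1 + ℓ2) (N2 * M * N1.transpose)) := by
  have hz : ∀ {m n d : ℕ}, revMat d (0 : Matrix (Fin m) (Fin n) F[X]) = 0 := by
    intro m n d; ext1 i j; simp [revMat]
  have k1 : revMat 1 K1 * (revMat ℓ1 N1)ᵀ = 0 := by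
    have := revMat_mul K1 N1ᵀ hK1deg (fun i j => hN1deg j i)
    rw [hKN1, hz] at this
    exact this.symm
  have k2 : revMat 1 K2 * (revMat ℓ2 N2)ᵀ = 0 := by
    have := revMat_mul K2 N2ᵀ hK2deg (fun i j => hN2deg j i)
    rw [hKN2, hz] at this
    exact this.symm
  have hQ : revMat (1 + ℓ1 + ℓ2) (N2 * M * N1ᵀ) =
      revMat ℓ2 N2 * revMat 1 M * (revMat ℓ1 N1)ᵀ := by
    have e : 1 + ℓ1 + ℓ2 = (ℓ2 + 1) + ℓ1 := by omega
    rw [e, revMat_mul (N2 * M) N1ᵀ (natDegree_mul_le' N2 M hN2deg hM) (fun i j => hN1deg j i),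
      revMat_mul N2 M hN2deg hM]
    rfl
  have hL : revMat 1 (Matrix.fromBlocks M K2ᵀ K1 0) =
      Matrix.fromBlocks (revMat 1 M) (revMat 1 K2)ᵀ (revMat 1 K1) 0 := by
    ext1 i j
    rcases i with i | i <;> rcases j with j | j <;> simp [revMat]
  rw [hQ, hL]
  exact block_lin ((finCongr (by omega)).trans finSumFinEquiv.symm)
    ((finCongr (by omega)).trans finSumFinEquiv.symm) _ _ _ _ k1 k2
    (poly_rinv _ (rev_rinv K1 hK1deg hK1lead hK1)) (poly_rinv _ (rev_rinv N1 hN1deg hN1lead hN1))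
    (poly_rinv _ (rev_rinv K2 hK2deg hK2lead hK2)) (poly_rinv _ (rev_rinv N2 hN2deg hN2lead hN2)) _
end

section
/- Let F be a field, P(λ) = Σ_{k=0}^{d} P_k λ^k ∈ F[λ]^{m×n}, and let L(λ) be an (ε,n,η,m)-block Kronecker pencil with ε+η+1 = d whose (1,1)-block is λM_1+M_0. Partition M_0 and M_1 into (η+1)×(ε+1) blocks of size m×n, denoted [M_0]_{ij}, [M_1]_{ij} for i = 1,…,η+1 and j = 1,…,ε+1. If for every k = 0,1,…,d one has Σ_{i+j = d+2−k} [M_1]_{ij} + Σ_{i+j = d+1−k} [M_0]_{ij} = P_k (sums over valid index pairs), then L(λ) is a strong linearization of P(λ) regarded as a polynomial of grade d. -/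
open Polynomial Matrix
open scoped Kronecker

/-- The `k×(k+1)` pencil `L_k(λ)` with `-1` on the main diagonal and `λ` on the superdiagonal. -/
noncomputable def Lk (R : Type*) [CommRing R] (k : ℕ) :
    Matrix (Fin k) (Fin (k + 1)) (Polynomial R) :=
  Matrix.of fun i j =>
    if (j : ℕ) = (i : ℕ) then -1 else if (j : ℕ) = (i : ℕ) + 1 then Polynomial.X else 0

/-- The `(k+1)×1` vector polynomial `Λ_k(λ) = (λ^k, λ^{k-1}, …, λ, 1)ᵀ`. -/
noncomputable def Lam (R : Type*) [CommRing R] (k : ℕ) :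
    Matrix (Fin (k + 1)) (Fin 1) (Polynomial R) :=
  Matrix.of fun i _ => Polynomial.X ^ (k - (i : ℕ))

/-- The `(ε,n,η,m)`-block Kronecker pencil
`L(λ) = [[λM₁+M₀, L_η(λ)ᵀ⊗I_m],[L_ε(λ)⊗I_n, 0]]`, whose `(1,1)` block is the pencil `M`. -/
noncomputable def blockKron (R : Type*) [CommRing R] (ε n η m : ℕ)
    (M : Matrix (Fin (η + 1) × Fin m) (Fin (ε + 1) × Fin n) (Polynomial R)) :
    Matrix ((Fin (η + 1) × Fin m) ⊕ (Fin ε × Fin n))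
      ((Fin (ε + 1) × Fin n) ⊕ (Fin η × Fin m)) (Polynomial R) :=
  Matrix.fromBlocks M
    ((Lk R η).transpose ⊗ₖ (1 : Matrix (Fin m) (Fin m) (Polynomial R)))
    ((Lk R ε) ⊗ₖ (1 : Matrix (Fin n) (Fin n) (Polynomial R))) 0

/-- `Q(λ) := (Λ_η(λ)ᵀ⊗I_m)·(λM₁+M₀)·(Λ_ε(λ)⊗I_n)`, the `m×n` matrix polynomial associated
with the `(1,1)` block `M` of a block Kronecker pencil. -/
noncomputable def QpolyOf (R : Type*) [CommRing R] (ε n η m : ℕ)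
    (M : Matrix (Fin (η + 1) × Fin m) (Fin (ε + 1) × Fin n) (Polynomial R)) :
    Matrix (Fin 1 × Fin m) (Fin 1 × Fin n) (Polynomial R) :=
  ((Lam R η).transpose ⊗ₖ (1 : Matrix (Fin m) (Fin m) (Polynomial R))) * M *
    ((Lam R ε) ⊗ₖ (1 : Matrix (Fin n) (Fin n) (Polynomial R)))

theorem isLin_of_dual {F : Type*} [Field F] {r c p q ι κ : Type*}
    [Fintype r] [Fintype c] [Fintype p] [Fintype q] [Fintype ι] [Fintype κ]
    [DecidableEq r] [DecidableEq c] [DecidableEq p] [DecidableEq q] [DecidableEq ι] [DecidableEq κ]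
    (er : r ≃ q ⊕ ι) (ec : c ≃ p ⊕ κ)
    (M : Matrix r c F[X])
    (K1 : Matrix p c F[X]) (W1 : Matrix c p F[X]) (N1 : Matrix c κ F[X]) (T1 : Matrix κ c F[X])
    (K2 : Matrix r q F[X]) (W2 : Matrix q r F[X]) (N2 : Matrix ι r F[X]) (T2 : Matrix r ι F[X])
    (h1 : K1 * W1 = 1) (h2 : K1 * N1 = 0) (h3 : T1 * W1 = 0) (h4 : T1 * N1 = 1)
    (g1 : W2 * K2 = 1) (g2 : N2 * K2 = 0) (g3 : W2 * T2 = 0) (g4 : N2 * T2 = 1) :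
    IsLinearization (fromBlocks M K2 K1 0) (N2 * M * N1) := by
  let U' : Matrix ((q ⊕ p) ⊕ ι) (r ⊕ p) F[X] :=
    fromRows (fromBlocks W2 (-(W2 * M * W1)) 0 1) (fromCols N2 (-(N2 * M * W1)))
  let V' : Matrix (c ⊕ q) ((q ⊕ p) ⊕ κ) F[X] :=
    fromCols (fromBlocks 0 W1 1 0) (fromRows N1 (-(W2 * M * N1)))
  let Ui : Matrix (r ⊕ p) ((q ⊕ p) ⊕ ι) F[X] :=
    fromCols (fromBlocks K2 (M * W1) 0 1) (fromRows T2 0)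
  let Vi : Matrix ((q ⊕ p) ⊕ κ) (c ⊕ q) F[X] :=
    fromRows (fromBlocks (W2 * M * N1 * T1) 1 K1 0) (fromCols T1 0)
  have hU : U' * Ui = 1 := by
    simp only [U', Ui]
    rw [fromRows_mul_fromCols, fromBlocks_multiply, fromBlocks_mul_fromRows, fromCols_mul_fromBlocks,
      fromCols_mul_fromRows]
    simp [g1, g2, g3, g4, Matrix.mul_assoc]
  have hV : Vi * V' = 1 := by
    simp only [V', Vi]
    rw [fromRows_mul_fromCols, fromBlocks_multiply, fromBlocks_mul_fromRows, fromCols_mul_fromBlocks,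
      fromCols_mul_fromRows]
    simp [h1, h2, h3, h4, Matrix.mul_assoc]
  have hm : U' * fromBlocks M K2 K1 0 * V' = fromBlocks 1 0 0 (N2 * M * N1) := by
    simp only [U', V']
    rw [fromRows_mul, fromBlocks_multiply, fromCols_mul_fromBlocks, fromRows_mul_fromCols,
      fromBlocks_multiply, fromBlocks_mul_fromRows, fromCols_mul_fromBlocks, fromCols_mul_fromRows]
    simp [h1, h2, g1, g2, Matrix.mul_assoc, Matrix.add_mul]
  let f : r ⊕ p ≃ (q ⊕ p) ⊕ ι :=
    ((Equiv.sumCongr er (Equiv.refl p)).trans (Equiv.sumAssoc q ι p)).trans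
      ((Equiv.sumCongr (Equiv.refl q) (Equiv.sumComm ι p)).trans (Equiv.sumAssoc q p ι).symm)
  let g : c ⊕ q ≃ (q ⊕ p) ⊕ κ :=
    ((Equiv.sumComm c q).trans (Equiv.sumCongr (Equiv.refl q) ec)).trans (Equiv.sumAssoc q p κ).symm
  let k := Fintype.equivFin (q ⊕ p)
  refine ⟨Fintype.card (q ⊕ p), f.trans (Equiv.sumCongr k (Equiv.refl ι)),
    g.trans (Equiv.sumCongr k (Equiv.refl κ)), U'.submatrix f id, V'.submatrix id g, ?_, ?_, ?_⟩
  · refine IsUnit.of_mul_eq_one (Ui.submatrix id f).det ?_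
    rw [← det_mul, ← submatrix_mul _ _ _ _ _ Function.bijective_id, hU]
    simp
  · refine IsUnit.of_mul_eq_one (Vi.submatrix g id).det ?_
    rw [mul_comm, ← det_mul, ← submatrix_mul _ _ _ _ _ Function.bijective_id, hV]
    simp
  · have : U'.submatrix f id * fromBlocks M K2 K1 0 * V'.submatrix id g =
      (U' * fromBlocks M K2 K1 0 * V').submatrix f g := by
      rw [submatrix_mul _ _ f id g Function.bijective_id,
        submatrix_mul _ _ f id id Function.bijective_id, submatrix_id_id]
    rw [this, hm]
    ext i j
    rcases i with i | i <;> rcases j with j | j <;> simp [Matrix.one_apply]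

theorem isLin_reindex {F : Type*} [Field F] {R C ι κ ι' κ' : Type*}
    [Fintype R] [Fintype C] [DecidableEq R] [DecidableEq C]
    (L : Matrix R C F[X]) (P : Matrix ι κ F[X]) (e : ι' ≃ ι) (e' : κ' ≃ κ)
    (h : IsLinearization L P) : IsLinearization L (P.submatrix e e') := by
  obtain ⟨s, er, ec, U, V, hU, hV, h⟩ := h
  refine ⟨s, er.trans (Equiv.sumCongr (Equiv.refl _) e.symm),
    ec.trans (Equiv.sumCongr (Equiv.refl _) e'.symm), U, V, hU, hV, ?_⟩
  have := congrArg (fun A => A.submatrix (Sum.map id e) (Sum.map id e')) h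
  ext1 i j
  have := congrFun (congrFun this i) j
  rcases i with i | i <;> rcases j with j | j <;> simpa using this

/-- General Kronecker version. -/
theorem isLin_kron {F : Type*} [Field F] (ε n η m : ℕ)
    (M : Matrix (Fin (η + 1) × Fin m) (Fin (ε + 1) × Fin n) F[X])
    (K : ∀ k : ℕ, Matrix (Fin k) (Fin (k + 1)) F[X])
    (W : ∀ k : ℕ, Matrix (Fin (k + 1)) (Fin k) F[X])
    (N : ∀ k : ℕ, Matrix (Fin (k + 1)) (Fin 1) F[X])
    (T : ∀ k : ℕ, Matrix (Fin 1) (Fin (k + 1)) F[X])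
    (h1 : ∀ k, K k * W k = 1) (h2 : ∀ k, K k * N k = 0) (h3 : ∀ k, T k * W k = 0)
    (h4 : ∀ k, T k * N k = 1) (P : Matrix (Fin m) (Fin n) F[X])
    (hP : ∀ a b, P a b = ∑ i : Fin (η + 1), ∑ j : Fin (ε + 1),
      N η i 0 * N ε j 0 * M (i, a) (j, b)) :
    IsLinearization (fromBlocks M ((K η)ᵀ ⊗ₖ (1 : Matrix (Fin m) (Fin m) F[X]))
      (K ε ⊗ₖ (1 : Matrix (Fin n) (Fin n) F[X])) 0) P := by
  have key := isLin_of_dual (F := F) (ι := Fin 1 × Fin m) (κ := Fin 1 × Fin n)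
    (Fintype.equivOfCardEq (by simp; ring)) (Fintype.equivOfCardEq (by simp; ring)) M
    (K ε ⊗ₖ (1 : Matrix (Fin n) (Fin n) F[X])) (W ε ⊗ₖ (1 : Matrix (Fin n) (Fin n) F[X]))
    (N ε ⊗ₖ (1 : Matrix (Fin n) (Fin n) F[X])) (T ε ⊗ₖ (1 : Matrix (Fin n) (Fin n) F[X]))
    ((K η)ᵀ ⊗ₖ (1 : Matrix (Fin m) (Fin m) F[X])) ((W η)ᵀ ⊗ₖ (1 : Matrix (Fin m) (Fin m) F[X]))
    ((N η)ᵀ ⊗ₖ (1 : Matrix (Fin m) (Fin m) F[X])) ((T η)ᵀ ⊗ₖ (1 : Matrix (Fin m) (Fin m) F[X]))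
    (by rw [← mul_kronecker_mul, h1]; simp) (by rw [← mul_kronecker_mul, h2]; simp)
    (by rw [← mul_kronecker_mul, h3]; simp) (by rw [← mul_kronecker_mul, h4]; simp)
    (by rw [← mul_kronecker_mul, ← transpose_mul, h1]; simp)
    (by rw [← mul_kronecker_mul, ← transpose_mul, h2]; simp)
    (by rw [← mul_kronecker_mul, ← transpose_mul, h3]; simp)
    (by rw [← mul_kronecker_mul, ← transpose_mul, h4]; simp)
  have := isLin_reindex _ _ (Equiv.uniqueProd (Fin m) (Fin 1)).symm
    (Equiv.uniqueProd (Fin n) (Fin 1)).symm key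
  convert this using 1
  ext1 a b
  rw [hP]
  simp only [submatrix_apply, Matrix.mul_apply, Fintype.sum_prod_type, kroneckerMap_apply,
    transpose_apply, Matrix.one_apply, Equiv.uniqueProd_symm_apply]
  simp only [mul_ite, ite_mul, mul_one, mul_zero, zero_mul, Finset.sum_ite_eq, Finset.sum_ite_eq',
    Finset.mem_univ, if_true, Finset.sum_mul]
  rw [Finset.sum_comm]
  refine Finset.sum_congr rfl fun j _ => Finset.sum_congr rfl fun i _ => ?_
  simp only [Fin.default_eq_zero, Fin.isValue]
  ring

noncomputable def WW (F : Type*) [Field F] (k : ℕ) : Matrix (Fin (k + 1)) (Fin k) F[X] :=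
  Matrix.of fun i j => if (i : ℕ) ≤ j then -X ^ ((j : ℕ) - i) else 0
noncomputable def WR (F : Type*) [Field F] (k : ℕ) : Matrix (Fin (k + 1)) (Fin k) F[X] :=
  Matrix.of fun i j => if (j : ℕ) < i then X ^ ((i : ℕ) - 1 - j) else 0
noncomputable def NR (F : Type*) [Field F] (k : ℕ) : Matrix (Fin (k + 1)) (Fin 1) F[X] :=
  Matrix.of fun i _ => X ^ (i : ℕ)
noncomputable def TT (F : Type*) [Field F] (k : ℕ) : Matrix (Fin 1) (Fin (k + 1)) F[X] :=
  Matrix.of fun _ j => if j = Fin.last k then 1 else 0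
noncomputable def TR (F : Type*) [Field F] (k : ℕ) : Matrix (Fin 1) (Fin (k + 1)) F[X] :=
  Matrix.of fun _ j => if j = 0 then 1 else 0

theorem sum_two {A : Type*} [CommRing A] (k : ℕ) (i : Fin k) (a b : A) (f : Fin (k + 1) → A) :
    ∑ j : Fin (k + 1), (if (j : ℕ) = (i : ℕ) then a else if (j : ℕ) = (i : ℕ) + 1 then b else 0)
      * f j = a * f i.castSucc + b * f i.succ := by
  have : ∀ j : Fin (k + 1), (if (j : ℕ) = (i : ℕ) then a else
      if (j : ℕ) = (i : ℕ) + 1 then b else 0) * f j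
      = (if j = i.castSucc then a * f j else 0) + (if j = i.succ then b * f j else 0) := by
    intro j
    simp only [Fin.ext_iff, Fin.val_castSucc, Fin.val_succ]
    split_ifs <;> first | omega | simp
  simp [this, Finset.sum_add_distrib]

theorem revLk (F : Type*) [Field F] (k : ℕ) : revMat 1 (Lk F k) = Matrix.of fun (i : Fin k) (j : Fin (k + 1)) =>
    if (j : ℕ) = (i : ℕ) then -X else if (j : ℕ) = (i : ℕ) + 1 then 1 else 0 := by
  ext1 i j
  have h1 : reflect 1 (1 : F[X]) = X := by
    simpa [revAt] using reflect_monomial (R := F) 1 0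
  have h2 : reflect 1 (X : F[X]) = 1 := by
    simpa [revAt] using reflect_monomial (R := F) 1 1
  simp only [revMat, Lk, of_apply]
  split_ifs <;> simp [h1, h2, reflect_neg]

theorem revKron (F : Type*) [Field F] (ε n η m : ℕ)
    (M : Matrix (Fin (η + 1) × Fin m) (Fin (ε + 1) × Fin n) F[X]) :
    revMat 1 (blockKron F ε n η m M) = fromBlocks (revMat 1 M)
      ((revMat 1 (Lk F η))ᵀ ⊗ₖ (1 : Matrix (Fin m) (Fin m) F[X]))
      (revMat 1 (Lk F ε) ⊗ₖ (1 : Matrix (Fin n) (Fin n) F[X])) 0 := by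
  ext1 i j
  rcases i with i | i <;> rcases j with j | j <;>
    simp [revMat, blockKron, Matrix.one_apply] <;> split_ifs <;> simp

theorem P_eq (F : Type*) [Field F] (ε n η m : ℕ)
    (P : Matrix (Fin m) (Fin n) (Polynomial F))
    (hPdeg : ∀ a b, (P a b).natDegree ≤ ε + η + 1)
    (M : Matrix (Fin (η + 1) × Fin m) (Fin (ε + 1) × Fin n) (Polynomial F))
    (hM : ∀ i j, (M i j).natDegree ≤ 1)
    (hcoeff : ∀ k : ℕ, k ≤ ε + η + 1 → ∀ (a : Fin m) (b : Fin n),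
      (∑ i : Fin (η + 1), ∑ j : Fin (ε + 1),
        if (i : ℕ) + (j : ℕ) + k = ε + η + 1 then (M (i, a) (j, b)).coeff 1 else 0) +
      (∑ i : Fin (η + 1), ∑ j : Fin (ε + 1),
        if (i : ℕ) + (j : ℕ) + k + 1 = ε + η + 1 then (M (i, a) (j, b)).coeff 0 else 0)
      = (P a b).coeff k) (a : Fin m) (b : Fin n) :
    P a b = ∑ i : Fin (η + 1), ∑ j : Fin (ε + 1),
      X ^ (η - (i : ℕ)) * X ^ (ε - (j : ℕ)) * M (i, a) (j, b) := by
  ext k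
  have hc : (P a b).coeff k = (∑ i : Fin (η + 1), ∑ j : Fin (ε + 1),
        if (i : ℕ) + (j : ℕ) + k = ε + η + 1 then (M (i, a) (j, b)).coeff 1 else 0) +
      (∑ i : Fin (η + 1), ∑ j : Fin (ε + 1),
        if (i : ℕ) + (j : ℕ) + k + 1 = ε + η + 1 then (M (i, a) (j, b)).coeff 0 else 0) := by
    by_cases hk : k ≤ ε + η + 1
    · exact (hcoeff k hk a b).symm
    · rw [coeff_eq_zero_of_natDegree_lt (by have := hPdeg a b; omega)]
      rw [Finset.sum_eq_zero, Finset.sum_eq_zero, add_zero]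
      all_goals
        intro i _
        refine Finset.sum_eq_zero fun j _ => if_neg (by omega)
  rw [hc, ← Finset.sum_add_distrib, finsetSum_coeff]
  refine Finset.sum_congr rfl fun i _ => ?_
  rw [← Finset.sum_add_distrib, finsetSum_coeff]
  refine Finset.sum_congr rfl fun j _ => ?_
  rw [← pow_add, coeff_X_pow_mul']
  have hi := i.2
  have hj := j.2
  split_ifs with h1 h2 h3 h3 h4 h4
  · omega
  · omega
  · rw [show k - (η - (i : ℕ) + (ε - (j : ℕ))) = 1 by omega, add_zero]
  · omega
  · rw [show k - (η - (i : ℕ) + (ε - (j : ℕ))) = 0 by omega, zero_add]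
  · omega
  · rw [coeff_eq_zero_of_natDegree_lt, add_zero]
    exact lt_of_le_of_lt (hM _ _) (by omega)
  · simp

theorem reflect_sum' {F : Type*} [Field F] {α : Type*} (s : Finset α) (d : ℕ) (f : α → F[X]) :
    reflect d (∑ i ∈ s, f i) = ∑ i ∈ s, reflect d (f i) := by
  classical
  induction s using Finset.induction_on with
  | empty => simp
  | insert a s ha ih => rw [Finset.sum_insert ha, Finset.sum_insert ha, reflect_add, ih]

/-- Let `P(λ) = Σ_{k=0}^d P_k λ^k ∈ F[λ]^{m×n}` and let `L(λ)` be an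
`(ε,n,η,m)`-block Kronecker pencil with `ε+η+1 = d` and `(1,1)` block `λM₁+M₀`, partitioned
into `(η+1)×(ε+1)` blocks `[M₁]_{ij}, [M₀]_{ij}` of size `m×n` (below indexed from `0`, so the
1-based paper condition `Σ_{i+j=d+2-k}[M₁]_{ij} + Σ_{i+j=d+1-k}[M₀]_{ij} = P_k` becomes
`Σ_{i+j+k=d}[M₁]_{ij} + Σ_{i+j+k+1=d}[M₀]_{ij} = P_k`). Then `L(λ)` is a strong linearization
of `P(λ)` regarded as a polynomial of grade `d`. -/
theorem statement_7 (F : Type*) [Field F] (ε n η m : ℕ)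
    (P : Matrix (Fin m) (Fin n) (Polynomial F))
    (hPdeg : ∀ a b, (P a b).natDegree ≤ ε + η + 1)
    (M : Matrix (Fin (η + 1) × Fin m) (Fin (ε + 1) × Fin n) (Polynomial F))
    (hM : ∀ i j, (M i j).natDegree ≤ 1)
    (hcoeff : ∀ k : ℕ, k ≤ ε + η + 1 → ∀ (a : Fin m) (b : Fin n),
      (∑ i : Fin (η + 1), ∑ j : Fin (ε + 1),
        if (i : ℕ) + (j : ℕ) + k = ε + η + 1 then (M (i, a) (j, b)).coeff 1 else 0) +
      (∑ i : Fin (η + 1), ∑ j : Fin (ε + 1),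
        if (i : ℕ) + (j : ℕ) + k + 1 = ε + η + 1 then (M (i, a) (j, b)).coeff 0 else 0)
      = (P a b).coeff k) :
    IsLinearization (blockKron F ε n η m M) P ∧
    IsLinearization (revMat 1 (blockKron F ε n η m M)) (revMat (ε + η + 1) P) := by

  have hP := P_eq F ε n η m P hPdeg M hM hcoeff
  constructor
  · refine isLin_kron ε n η m M (Lk F) (WW F) (Lam F) (TT F) ?_ ?_ ?_ ?_ P ?_
    · intro k
      ext1 i j
      rw [Matrix.mul_apply]
      simp only [Lk, of_apply]
      rw [sum_two]
      simp only [WW, of_apply, Matrix.one_apply, Fin.val_castSucc, Fin.val_succ, Fin.ext_iff]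
      rcases lt_trichotomy (i : ℕ) j with h | h | h
      · rw [if_pos h.le, if_pos (by omega), if_neg h.ne, show (j : ℕ) - i = (j - (i + 1)) + 1 by omega]
        ring
      · simp [h]
      · rw [if_neg (by omega), if_neg (by omega), if_neg (by omega)]; simp
    · intro k
      ext1 i j
      rw [Matrix.mul_apply]
      simp only [Lk, of_apply]
      rw [sum_two]
      simp only [Lam, of_apply, Fin.val_castSucc, Fin.val_succ, Matrix.zero_apply]
      rw [show k - (i : ℕ) = (k - (i + 1)) + 1 by omega]
      ring
    · intro k
      ext1 i j
      rw [Matrix.mul_apply, Matrix.zero_apply]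
      refine Finset.sum_eq_zero fun l _ => ?_
      simp only [TT, WW, of_apply, Fin.ext_iff, Fin.val_last, Fin.val_zero]
      split_ifs <;> first | omega | simp
    · intro k
      ext1 i j
      obtain rfl := Subsingleton.elim i j
      simp [Matrix.mul_apply, TT, Lam]
    · intro a b
      rw [hP]
      rfl
  · rw [revKron]
    refine isLin_kron ε n η m (revMat 1 M) (fun k => revMat 1 (Lk F k)) (WR F) (NR F) (TR F)
      ?_ ?_ ?_ ?_ _ ?_
    · intro k
      ext1 i j
      rw [Matrix.mul_apply]
      simp only [revLk, of_apply]
      rw [sum_two]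
      simp only [WR, of_apply, Matrix.one_apply, Fin.val_castSucc, Fin.val_succ, Fin.ext_iff]
      rcases lt_trichotomy (i : ℕ) j with h | h | h
      · rw [if_neg (by omega), if_neg (by omega), if_neg (by omega)]; simp
      · simp [h]
      · rw [if_pos h, if_pos (by omega), if_neg (by omega),
          show (i : ℕ) + 1 - 1 - j = (i - 1 - j) + 1 by omega]
        ring
    · intro k
      ext1 i j
      rw [Matrix.mul_apply]
      simp only [revLk, of_apply]
      rw [sum_two]
      simp only [NR, of_apply, Fin.val_castSucc, Fin.val_succ, Matrix.zero_apply]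
      ring
    · intro k
      ext1 i j
      rw [Matrix.mul_apply, Matrix.zero_apply]
      refine Finset.sum_eq_zero fun l _ => ?_
      simp only [TR, WR, of_apply, Fin.ext_iff, Fin.val_last, Fin.val_zero]
      split_ifs <;> first | omega | simp
    · intro k
      ext1 i j
      obtain rfl := Subsingleton.elim i j
      simp [Matrix.mul_apply, TR, NR]
    · intro a b
      simp only [revMat, of_apply, NR]
      rw [hP, reflect_sum']
      refine Finset.sum_congr rfl fun i _ => ?_
      rw [reflect_sum']
      refine Finset.sum_congr rfl fun j _ => ?_
      have hi := i.2
      have hj := j.2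
      rw [← pow_add, ← pow_add, reflect_mul (F := ε + η) (G := 1) _ _
        (by rw [natDegree_X_pow]; omega) (hM _ _), reflect_monomial, revAt_le (by omega)]
      congr 2
      omega
end

section
/- Let m, n ≥ 1 and ε, η ≥ 1 be integers and let T := [[E_{ηm}⊗I_{εn}, I_{ηm}⊗E_{εn}],[F_{ηm}⊗I_{εn}, I_{ηm}⊗F_{εn}]] ∈ ℝ^{2εηmn × ((η+1)mεn + ηm(ε+1)n)}. Define c := 2·sin(π/(4·min(ε,η)+2)) if ε ≠ η and c := 2·sin(π/(4η)) if ε = η. Then TTᵀ − c²·I is positive semidefinite and singular (det(TTᵀ − c²I) = 0); in particular T has full row rank and its smallest singular value equals c. -/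
open Matrix
open scoped Kronecker

/-- The `k×(k+1)` matrix `E_k = [I_k, 0]`. -/
def EkMat (R : Type*) [CommRing R] (k : ℕ) : Matrix (Fin k) (Fin (k + 1)) R :=
  Matrix.of fun i j => if (j : ℕ) = (i : ℕ) then 1 else 0

/-- The `k×(k+1)` matrix `F_k = [0, I_k]`. -/
def FkMat (R : Type*) [CommRing R] (k : ℕ) : Matrix (Fin k) (Fin (k + 1)) R :=
  Matrix.of fun i j => if (j : ℕ) = (i : ℕ) + 1 then 1 else 0

/-- The matrix `T = [[E_{ηm}⊗I_{εn}, I_{ηm}⊗E_{εn}],[F_{ηm}⊗I_{εn}, I_{ηm}⊗F_{εn}]]`, where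
`E_{kℓ} = [I_k,0]⊗I_ℓ` and `F_{kℓ} = [0,I_k]⊗I_ℓ`. -/
def Tmat (m n ε η : ℕ) :
    Matrix (((Fin η × Fin m) × (Fin ε × Fin n)) ⊕ ((Fin η × Fin m) × (Fin ε × Fin n)))
      (((Fin (η + 1) × Fin m) × (Fin ε × Fin n)) ⊕ ((Fin η × Fin m) × (Fin (ε + 1) × Fin n))) ℝ :=
  Matrix.fromBlocks
    ((EkMat ℝ η ⊗ₖ (1 : Matrix (Fin m) (Fin m) ℝ)) ⊗ₖ
      (1 : Matrix (Fin ε × Fin n) (Fin ε × Fin n) ℝ))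
    ((1 : Matrix (Fin η × Fin m) (Fin η × Fin m) ℝ) ⊗ₖ
      (EkMat ℝ ε ⊗ₖ (1 : Matrix (Fin n) (Fin n) ℝ)))
    ((FkMat ℝ η ⊗ₖ (1 : Matrix (Fin m) (Fin m) ℝ)) ⊗ₖ
      (1 : Matrix (Fin ε × Fin n) (Fin ε × Fin n) ℝ))
    ((1 : Matrix (Fin η × Fin m) (Fin η × Fin m) ℝ) ⊗ₖ
      (FkMat ℝ ε ⊗ₖ (1 : Matrix (Fin n) (Fin n) ℝ)))

theorem aux_psd {ι : Type*} [Fintype ι] [DecidableEq ι] (A : Matrix ι ι ℝ) (l : ℝ) (w : ι → ℝ)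
    (hs : Aᵀ = A) (h0 : ∀ i j, 0 ≤ A i j) (hw : ∀ i, 0 < w i)
    (hA : ∀ i, (A *ᵥ w) i ≤ l * w i) : (A + l • (1 : Matrix ι ι ℝ)).PosSemidef := by
  have hsym : ∀ i j, A i j = A j i := fun i j => by
    conv_lhs => rw [← hs]
    rfl
  refine Matrix.PosSemidef.of_dotProduct_mulVec_nonneg ?_ ?_
  · ext i j
    simp [Matrix.conjTranspose_apply, Matrix.one_apply, hsym j i, eq_comm]
  intro x
  have key : ∀ i j, 0 ≤ A i j * x i * x j + (1/2) * (A i j * w j * (x i ^ 2 / w i))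
      + (1/2) * (A j i * w i * (x j ^ 2 / w j)) := by
    intro i j
    rw [hsym j i]
    have hi := hw i
    have hj := hw j
    have : A i j * x i * x j + (1/2) * (A i j * w j * (x i ^ 2 / w i))
      + (1/2) * (A i j * w i * (x j ^ 2 / w j))
      = A i j * ((x i * w j + x j * w i) ^ 2 / (2 * w i * w j)) := by
      field_simp
      ring
    rw [this]
    have := h0 i j
    positivity
  have hsum : 0 ≤ ∑ i, ∑ j, (A i j * x i * x j + (1/2) * (A i j * w j * (x i ^ 2 / w i))
      + (1/2) * (A j i * w i * (x j ^ 2 / w j))) :=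
    Finset.sum_nonneg fun i _ => Finset.sum_nonneg fun j _ => key i j
  simp only [Finset.sum_add_distrib] at hsum
  rw [Finset.sum_comm (f := fun i j => (1/2) * (A j i * w i * (x j ^ 2 / w j)))] at hsum
  have h2 : ∑ i, ∑ j, (1/2) * (A i j * w j * (x i ^ 2 / w i)) ≤ (1/2) * ∑ i, l * x i ^ 2 := by
    rw [Finset.mul_sum]
    refine Finset.sum_le_sum fun i _ => ?_
    rw [← Finset.mul_sum, ← Finset.sum_mul]
    have h3 := hA i
    simp only [Matrix.mulVec, dotProduct] at h3
    have hi := hw i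
    have h4 : 0 ≤ x i ^ 2 / w i := by positivity
    have h5 := mul_le_mul_of_nonneg_right h3 h4
    have h6 : l * w i * (x i ^ 2 / w i) = l * x i ^ 2 := by field_simp
    linarith
  have h7 : star x ⬝ᵥ ((A + l • (1 : Matrix ι ι ℝ)) *ᵥ x) =
      ∑ i, ∑ j, A i j * x i * x j + ∑ i, l * x i ^ 2 := by
    rw [Matrix.add_mulVec, Matrix.smul_mulVec, Matrix.one_mulVec]
    simp only [dotProduct, Matrix.mulVec, Pi.add_apply, Pi.smul_apply, smul_eq_mul, mul_add,
      Finset.sum_add_distrib, Finset.mul_sum]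
    congr 1
    · refine Finset.sum_congr rfl fun i _ => Finset.sum_congr rfl fun j _ => ?_
      simp
      ring
    · refine Finset.sum_congr rfl fun i _ => ?_
      simp
      ring
  rw [h7]
  linarith

def auxN (k : ℕ) : Matrix (Fin k) (Fin k) ℝ :=
  Matrix.of fun i j => if (i : ℕ) = (j : ℕ) + 1 then 1 else 0

theorem aux_EF (k : ℕ) : EkMat ℝ k * (FkMat ℝ k)ᵀ = auxN k := by
  ext i j
  simp only [Matrix.mul_apply, EkMat, FkMat, auxN, Matrix.of_apply, Matrix.transpose_apply]
  rw [Finset.sum_eq_single (Fin.castSucc i)]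
  · simp
  · intro b _ hb
    have : (b : ℕ) ≠ i := fun h => hb (Fin.ext (by simpa using h))
    simp [this]
  · simp

theorem aux_FE (k : ℕ) : FkMat ℝ k * (EkMat ℝ k)ᵀ = (auxN k)ᵀ := by
  rw [← aux_EF, Matrix.transpose_mul, Matrix.transpose_transpose]

theorem aux_EE (k : ℕ) : EkMat ℝ k * (EkMat ℝ k)ᵀ = 1 := by
  ext i j
  simp only [Matrix.mul_apply, EkMat, Matrix.of_apply, Matrix.transpose_apply]
  rw [Finset.sum_eq_single (Fin.castSucc i)]
  · simp [Matrix.one_apply, Fin.ext_iff]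
  · intro b _ hb
    have : (b : ℕ) ≠ i := fun h => hb (Fin.ext (by simpa using h))
    simp [this]
  · simp

theorem aux_FF (k : ℕ) : FkMat ℝ k * (FkMat ℝ k)ᵀ = 1 := by
  ext i j
  simp only [Matrix.mul_apply, FkMat, Matrix.of_apply, Matrix.transpose_apply]
  rw [Finset.sum_eq_single (Fin.succ i)]
  · simp [Matrix.one_apply, Fin.ext_iff]
  · intro b _ hb
    have : (b : ℕ) ≠ i + 1 := fun h => hb (Fin.ext (by simpa using h))
    simp [this]
  · simp

def auxB (m n ε η : ℕ) :
    Matrix ((Fin η × Fin m) × (Fin ε × Fin n)) ((Fin η × Fin m) × (Fin ε × Fin n)) ℝ :=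
  (auxN η ⊗ₖ (1 : Matrix (Fin m) (Fin m) ℝ)) ⊗ₖ (1 : Matrix (Fin ε × Fin n) (Fin ε × Fin n) ℝ)
  + (1 : Matrix (Fin η × Fin m) (Fin η × Fin m) ℝ) ⊗ₖ
      (auxN ε ⊗ₖ (1 : Matrix (Fin n) (Fin n) ℝ))

theorem aux_TT (m n ε η : ℕ) : Tmat m n ε η * (Tmat m n ε η)ᵀ =
    Matrix.fromBlocks 0 (auxB m n ε η) (auxB m n ε η)ᵀ 0 + (2 : ℝ) • 1 := by
  have h2 : ((2 : ℝ) • 1 : Matrix (((Fin η × Fin m) × (Fin ε × Fin n)) ⊕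
      ((Fin η × Fin m) × (Fin ε × Fin n))) (((Fin η × Fin m) × (Fin ε × Fin n)) ⊕
      ((Fin η × Fin m) × (Fin ε × Fin n))) ℝ) = Matrix.fromBlocks (1 + 1) 0 0 (1 + 1) := by
    rw [← Matrix.fromBlocks_one, Matrix.fromBlocks_smul, two_smul, smul_zero]
  rw [h2, Tmat, Matrix.fromBlocks_transpose, Matrix.fromBlocks_multiply, Matrix.fromBlocks_add]
  simp only [← Matrix.kroneckerMap_transpose, ← Matrix.mul_kronecker_mul, Matrix.transpose_one,
    Matrix.one_mul, aux_EE, aux_FF, aux_EF, aux_FE, Matrix.one_kronecker_one, auxB,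
    Matrix.transpose_add, zero_add, add_zero]

theorem aux_N_mul (k : ℕ) (i : Fin k) (f : ℕ → ℝ) :
    ∑ j : Fin k, auxN k i j * f j = if 1 ≤ (i : ℕ) then f (i - 1) else 0 := by
  simp only [auxN, Matrix.of_apply]
  split_ifs with h
  · rw [Finset.sum_eq_single ⟨i - 1, by omega⟩]
    · have : (i : ℕ) = i - 1 + 1 := by omega
      simp [← this]
    · intro b _ hb
      have : (i : ℕ) ≠ b + 1 := fun h => hb (Fin.ext (by simp; omega))
      simp [this]
    · simp
  · refine Finset.sum_eq_zero fun b _ => ?_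
    have : (i : ℕ) ≠ b + 1 := by omega
    simp [this]

theorem aux_Nt_mul (k : ℕ) (i : Fin k) (f : ℕ → ℝ) :
    ∑ j : Fin k, auxN k j i * f j = if (i : ℕ) + 1 < k then f (i + 1) else 0 := by
  simp only [auxN, Matrix.of_apply]
  split_ifs with h
  · rw [Finset.sum_eq_single ⟨i + 1, h⟩]
    · simp
    · intro b _ hb
      have : (b : ℕ) ≠ i + 1 := fun h => hb (Fin.ext (by simp; omega))
      simp [this]
    · simp
  · refine Finset.sum_eq_zero fun b _ => ?_
    have : (b : ℕ) ≠ i + 1 := by omega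
    simp [this]

theorem aux_B_mul (m n ε η : ℕ) (f : ℕ → ℕ → ℝ) (i : Fin η) (a : Fin m) (j : Fin ε) (b : Fin n) :
    (auxB m n ε η *ᵥ fun p => f p.1.1 p.2.1) ((i, a), (j, b)) =
      (if 1 ≤ (i : ℕ) then f (i - 1) j else 0) + (if 1 ≤ (j : ℕ) then f i (j - 1) else 0) := by
  rw [← aux_N_mul η i (fun x => f x j), ← aux_N_mul ε j (fun x => f i x)]
  simp only [auxB, Matrix.add_mulVec, Pi.add_apply]
  congr 1
  · simp [Matrix.mulVec, dotProduct, Fintype.sum_prod_type, Matrix.kroneckerMap_apply,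
      Matrix.one_apply]
  · simp [Matrix.mulVec, dotProduct, Fintype.sum_prod_type, Matrix.kroneckerMap_apply,
      Matrix.one_apply]

theorem aux_Bt_mul (m n ε η : ℕ) (f : ℕ → ℕ → ℝ) (i : Fin η) (a : Fin m) (j : Fin ε) (b : Fin n) :
    ((auxB m n ε η)ᵀ *ᵥ fun p => f p.1.1 p.2.1) ((i, a), (j, b)) =
      (if (i : ℕ) + 1 < η then f (i + 1) j else 0) +
      (if (j : ℕ) + 1 < ε then f i (j + 1) else 0) := by
  rw [← aux_Nt_mul η i (fun x => f x j), ← aux_Nt_mul ε j (fun x => f i x)]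
  simp only [auxB, Matrix.transpose_add, Matrix.add_mulVec, Pi.add_apply]
  congr 1
  · simp [Matrix.mulVec, dotProduct, Fintype.sum_prod_type, Matrix.kroneckerMap_apply,
      Matrix.one_apply]
  · simp [Matrix.mulVec, dotProduct, Fintype.sum_prod_type, Matrix.kroneckerMap_apply,
      Matrix.one_apply]

/-- Weights making `l` an upper bound. -/
def auxP (η ε : ℕ) (l : ℝ) : Prop :=
  ∃ x y : ℕ → ℕ → ℝ, ∀ i j, i < η → j < ε → 0 < x i j ∧ 0 < y i j ∧
    (if 1 ≤ i then y (i - 1) j else 0) + (if 1 ≤ j then y i (j - 1) else 0) ≤ l * x i j ∧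
    (if i + 1 < η then x (i + 1) j else 0) + (if j + 1 < ε then x i (j + 1) else 0) ≤ l * y i j

/-- Eigenvector. -/
def auxQ (η ε : ℕ) (l : ℝ) : Prop :=
  ∃ x y : ℕ → ℕ → ℝ, (∃ i j, i < η ∧ j < ε ∧ x i j ≠ 0) ∧ ∀ i j, i < η → j < ε →
    (if 1 ≤ i then y (i - 1) j else 0) + (if 1 ≤ j then y i (j - 1) else 0) = l * x i j ∧
    (if i + 1 < η then x (i + 1) j else 0) + (if j + 1 < ε then x i (j + 1) else 0) = l * y i j

theorem auxP_swap {η ε : ℕ} {l : ℝ} (h : auxP η ε l) : auxP ε η l := by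
  obtain ⟨x, y, h⟩ := h
  refine ⟨fun i j => x j i, fun i j => y j i, fun i j hi hj => ?_⟩
  obtain ⟨h1, h2, h3, h4⟩ := h j i hj hi
  exact ⟨h1, h2, by rw [add_comm]; exact h3, by rw [add_comm]; exact h4⟩

theorem auxQ_swap {η ε : ℕ} {l : ℝ} (h : auxQ η ε l) : auxQ ε η l := by
  obtain ⟨x, y, ⟨i, j, hi, hj, hx⟩, h⟩ := h
  refine ⟨fun i j => x j i, fun i j => y j i, ⟨j, i, hj, hi, hx⟩, fun i j hi hj => ?_⟩
  obtain ⟨h3, h4⟩ := h j i hj hi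
  exact ⟨by rw [add_comm]; exact h3, by rw [add_comm]; exact h4⟩

/-- Path eigenvector. -/
def auxS (N : ℕ) (l : ℝ) (S : ℕ → ℝ) : Prop :=
  S 0 = 0 ∧ S (N + 1) = 0 ∧ (∀ p, 1 ≤ p → p ≤ N → 0 < S p) ∧ ∀ p, S p + S (p + 2) = l * S (p + 1)

theorem auxS_sin (N : ℕ) :
    auxS N (2 * Real.cos (Real.pi / (N + 1))) (fun p => Real.sin (p * (Real.pi / (N + 1)))) := by
  have hN : (0 : ℝ) < N + 1 := by positivity
  refine ⟨by simp, ?_, ?_, ?_⟩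
  · simp only [Nat.cast_add, Nat.cast_one]
    rw [mul_div_cancel₀ _ hN.ne', Real.sin_pi]
  · intro p h1 h2
    have h1' : (0 : ℝ) < p := by exact_mod_cast h1
    have h2' : (p : ℝ) < N + 1 := by exact_mod_cast Nat.lt_succ_of_le h2
    have := Real.pi_pos
    apply Real.sin_pos_of_pos_of_lt_pi
    · positivity
    · rw [mul_div_assoc', div_lt_iff₀ hN]
      nlinarith
  · intro p
    generalize Real.pi / ((N : ℝ) + 1) = t
    push_cast
    have e1 : (p : ℝ) * t = (p + 1) * t - t := by ring
    have e2 : ((p : ℝ) + 2) * t = (p + 1) * t + t := by ring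
    rw [e1, e2, Real.sin_sub, Real.sin_add]
    ring

theorem auxS_nonneg {N : ℕ} {l : ℝ} {S : ℕ → ℝ} (h : auxS N l S) (p : ℕ) (hp : p ≤ N + 1) :
    0 ≤ S p := by
  obtain ⟨h0, h1, h2, _⟩ := h
  rcases Nat.eq_zero_or_pos p with rfl | h3
  · exact h0.ge
  rcases hp.eq_or_lt with rfl | h4
  · exact h1.ge
  exact (h2 p h3 (by omega)).le

theorem auxP_lt {η ε : ℕ} {l : ℝ} {S : ℕ → ℝ} (h : auxS (2 * η) l S) : auxP η ε l := by
  have hn := auxS_nonneg h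
  obtain ⟨h0, h1, h2, h3⟩ := h
  refine ⟨fun i _ => S (2 * i + 1), fun i _ => S (2 * i + 2), fun i j hi hj =>
    ⟨h2 _ (by omega) (by omega), h2 _ (by omega) (by omega), ?_, ?_⟩⟩
  · rw [← h3]
    have a := hn (2 * i) (by omega)
    have b := hn (2 * i + 2) (by omega)
    refine add_le_add ?_ ?_
    · split_ifs with hh
      · dsimp only; rw [show 2 * (i - 1) + 2 = 2 * i by omega]
      · exact a
    · split_ifs
      · exact le_rfl
      · exact b
  · have := h3 (2 * i + 1)
    rw [← this, add_comm]
    have a := hn (2 * i + 1) (by omega)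
    have b := hn (2 * i + 3) (by omega)
    refine add_le_add ?_ ?_
    · split_ifs
      · exact le_rfl
      · exact a
    · split_ifs with hh
      · exact le_rfl
      · exact b

theorem auxP_eq {η M : ℕ} {l : ℝ} {S : ℕ → ℝ} (hM : M + 1 = 2 * η) (h : auxS M l S) :
    auxP η η l := by
  have hn := auxS_nonneg h
  obtain ⟨h0, h1, h2, h3⟩ := h
  refine ⟨fun i j => if i + j < η then S (2 * i + 1) else S (2 * i),
    fun i j => if i + j + 1 < η then S (2 * i + 2) else S (2 * i + 1), fun i j hi hj =>
    ⟨?_, ?_, ?_, ?_⟩⟩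
  · dsimp only
    split_ifs
    · exact h2 _ (by omega) (by omega)
    · exact h2 _ (by omega) (by omega)
  · dsimp only
    split_ifs
    · exact h2 _ (by omega) (by omega)
    · exact h2 _ (by omega) (by omega)
  · dsimp only
    by_cases hd : i + j < η
    · rw [if_pos hd, ← h3]
      have a := hn (2 * i) (by omega)
      have b := hn (2 * i + 2) (by omega)
      refine add_le_add ?_ ?_
      · split_ifs with h5 h6
        · rw [show 2 * (i - 1) + 2 = 2 * i by omega]
        · omega
        · exact a
      · split_ifs with h5 h6
        · exact le_rfl
        · omega
        · exact b
    · rw [if_neg hd]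
      obtain ⟨k, rfl⟩ : ∃ k, i = k + 1 := ⟨i - 1, by omega⟩
      have := h3 (2 * k + 1)
      rw [show 2 * (k + 1) = 2 * k + 1 + 1 by ring, ← this]
      have a := hn (2 * k + 1) (by omega)
      have b := hn (2 * k + 3) (by omega)
      refine add_le_add ?_ ?_
      · split_ifs with h5 h6
        · omega
        · exact le_rfl
        · exact a
      · split_ifs with h5 h6
        · omega
        · exact le_rfl
        · exact b
  · dsimp only
    by_cases hd : i + j + 1 < η
    · rw [if_pos hd, show 2 * i + 2 = 2 * i + 1 + 1 by ring, ← h3, add_comm]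
      have a := hn (2 * i + 1) (by omega)
      have b := hn (2 * i + 3) (by omega)
      refine add_le_add ?_ ?_
      · split_ifs with h5 h6
        · exact le_rfl
        · omega
        · exact a
      · split_ifs with h5 h6
        · exact le_rfl
        · omega
        · exact b
    · rw [if_neg hd, ← h3, add_comm]
      have a := hn (2 * i) (by omega)
      have b := hn (2 * i + 2) (by omega)
      refine add_le_add ?_ ?_
      · split_ifs with h5 h6
        · omega
        · exact le_rfl
        · exact a
      · split_ifs with h5 h6
        · omega
        · exact le_rfl
        · exact b

theorem auxQ_gen {η ε N d : ℕ} {l : ℝ} {S : ℕ → ℝ} (hη : 1 ≤ η) (hd : d < ε)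
    (hN : (N = 2 * η ∧ d = η) ∨ (N + 1 = 2 * η ∧ d + 1 = η)) (h : auxS N l S) :
    auxQ η ε l := by
  obtain ⟨h0, h1, h2, h3⟩ := h
  refine ⟨fun i j => if i + j = d then S (2 * i + 1) else 0,
    fun i j => if i + j + 1 = d then S (2 * i + 2) else 0,
    ⟨0, d, by omega, hd, ?_⟩, fun i j hi hj => ⟨?_, ?_⟩⟩
  · simpa using (h2 1 le_rfl (by omega)).ne'
  · dsimp only
    by_cases hd : i + j = d
    · rw [if_pos hd, ← h3]
      congr 1
      · split_ifs with h5 h6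
        · rw [show 2 * (i - 1) + 2 = 2 * i by omega]
        · omega
        · rw [show i = 0 by omega, h0]
      · split_ifs with h5 h6
        · rfl
        · omega
        · rw [← h1]; congr 1; omega
    · rw [if_neg hd, mul_zero]
      split_ifs <;> first | omega | simp
  · dsimp only
    by_cases hd : i + j + 1 = d
    · rw [if_pos hd, show 2 * i + 2 = 2 * i + 1 + 1 by ring, ← h3, add_comm]
      congr 1
      · split_ifs with h5 h6
        · rfl
        · omega
        · omega
      · split_ifs with h5 h6
        · rfl
        · omega
        · rw [← h1]; congr 1; omega
    · rw [if_neg hd, mul_zero]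
      split_ifs <;> first | omega | simp

theorem aux_main (m n ε η : ℕ) (hm : 1 ≤ m) (hn : 1 ≤ n)
    (c : ℝ) (hc : 0 < c) (hP : auxP η ε (2 - c ^ 2)) (hQ : auxQ η ε (2 - c ^ 2)) :
    (Tmat m n ε η * (Tmat m n ε η).transpose - c ^ 2 • 1).PosSemidef ∧
    (Tmat m n ε η * (Tmat m n ε η).transpose - c ^ 2 • 1).det = 0 ∧
    (Tmat m n ε η).rank = 2 * ε * η * m * n := by
  have hM : Tmat m n ε η * (Tmat m n ε η).transpose - c ^ 2 • 1 =
      Matrix.fromBlocks 0 (auxB m n ε η) (auxB m n ε η)ᵀ 0 + (2 - c ^ 2) • 1 := by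
    rw [aux_TT, sub_smul, add_sub_assoc]
  have hB0 : ∀ p q, 0 ≤ auxB m n ε η p q := by
    intro p q
    simp only [auxB, auxN, Matrix.add_apply, Matrix.kroneckerMap_apply, Matrix.one_apply,
      Matrix.of_apply]
    positivity
  have hpsd : (Tmat m n ε η * (Tmat m n ε η).transpose - c ^ 2 • 1).PosSemidef := by
    rw [hM]
    obtain ⟨x, y, h⟩ := hP
    refine aux_psd _ _ (Sum.elim (fun p => x p.1.1 p.2.1) (fun p => y p.1.1 p.2.1)) ?_ ?_ ?_ ?_
    · simp [Matrix.fromBlocks_transpose]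
    · rintro (p | p) (q | q) <;> simp [hB0]
    · rintro (⟨⟨i, a⟩, ⟨j, b⟩⟩ | ⟨⟨i, a⟩, ⟨j, b⟩⟩)
      · exact (h i j i.2 j.2).1
      · exact (h i j i.2 j.2).2.1
    · rw [Matrix.fromBlocks_mulVec]
      rintro (⟨⟨i, a⟩, ⟨j, b⟩⟩ | ⟨⟨i, a⟩, ⟨j, b⟩⟩)
      · simp only [Sum.elim_inl, Sum.elim_comp_inl, Sum.elim_comp_inr, Matrix.zero_mulVec, zero_add]
        rw [aux_B_mul]
        exact (h i j i.2 j.2).2.2.1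
      · simp only [Sum.elim_inr, Sum.elim_comp_inl, Sum.elim_comp_inr, Matrix.zero_mulVec, add_zero]
        rw [aux_Bt_mul]
        exact (h i j i.2 j.2).2.2.2
  refine ⟨hpsd, ?_, ?_⟩
  · rw [hM, ← Matrix.exists_mulVec_eq_zero_iff]
    obtain ⟨x, y, ⟨i0, j0, hi0, hj0, hx⟩, h⟩ := hQ
    refine ⟨Sum.elim (fun p => x p.1.1 p.2.1) (-(fun p => y p.1.1 p.2.1)), ?_, ?_⟩
    · intro h0
      have := congrFun h0 (Sum.inl ((⟨i0, hi0⟩, ⟨0, hm⟩), (⟨j0, hj0⟩, ⟨0, hn⟩)))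
      exact hx (by simpa using this)
    · rw [Matrix.add_mulVec, Matrix.smul_mulVec, Matrix.one_mulVec, Matrix.fromBlocks_mulVec]
      ext (⟨⟨i, a⟩, ⟨j, b⟩⟩ | ⟨⟨i, a⟩, ⟨j, b⟩⟩)
      · simp only [Pi.add_apply, Pi.smul_apply, Sum.elim_inl, Sum.elim_comp_inl, Sum.elim_comp_inr,
          Matrix.zero_mulVec, zero_add, Matrix.mulVec_neg, Pi.neg_apply]
        rw [aux_B_mul, (h i j i.2 j.2).1]
        simp
      · simp only [Pi.add_apply, Pi.smul_apply, Sum.elim_inr, Sum.elim_comp_inl, Sum.elim_comp_inr,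
          Matrix.zero_mulVec, add_zero, Pi.neg_apply]
        rw [aux_Bt_mul, (h i j i.2 j.2).2]
        simp
  · have hpd : (Tmat m n ε η * (Tmat m n ε η)ᵀ).PosDef := by
      have h1 := Matrix.PosDef.posSemidef_add hpsd
        (Matrix.PosDef.smul Matrix.PosDef.one (pow_pos hc 2))
      simpa using h1
    rw [← Matrix.rank_self_mul_transpose, Matrix.rank_of_isUnit _ hpd.isUnit]
    simp
    ring

/-- With `c = 2 sin(π/(4 min(ε,η)+2))` for `ε ≠ η` and `c = 2 sin(π/(4η))` for
`ε = η`, the matrix `T·Tᵀ − c²·I` is positive semidefinite and singular; in particular `T` has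
full row rank `2εηmn` and its smallest singular value equals `c`. -/
theorem statement_8 (m n ε η : ℕ) (hm : 1 ≤ m) (hn : 1 ≤ n) (hε : 1 ≤ ε) (hη : 1 ≤ η)
    (c : ℝ)
    (hc : c = if ε = η then 2 * Real.sin (Real.pi / (4 * (η : ℝ)))
      else 2 * Real.sin (Real.pi / (4 * ((min ε η : ℕ) : ℝ) + 2))) :
    (Tmat m n ε η * (Tmat m n ε η).transpose - c ^ 2 • 1).PosSemidef ∧
    (Tmat m n ε η * (Tmat m n ε η).transpose - c ^ 2 • 1).det = 0 ∧
    (Tmat m n ε η).rank = 2 * ε * η * m * n := by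
  have hpi := Real.pi_pos
  have key : ∀ t : ℝ, 2 - (2 * Real.sin t) ^ 2 = 2 * Real.cos (2 * t) := by
    intro t
    rw [Real.cos_two_mul, Real.cos_sq']
    ring
  by_cases h : ε = η
  · subst h
    rw [if_pos rfl] at hc
    have hε' : (1 : ℝ) ≤ ε := by exact_mod_cast hε
    obtain ⟨M, hM⟩ : ∃ M, M + 1 = 2 * ε := ⟨2 * ε - 1, by omega⟩
    have hM' : (M : ℝ) + 1 = 2 * ε := by exact_mod_cast hM
    have hS := auxS_sin M
    have hl : 2 * Real.cos (Real.pi / (M + 1)) = 2 - c ^ 2 := by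
      rw [hc, key, hM']
      congr 2
      field_simp
      norm_num
    rw [hl] at hS
    refine aux_main m n ε ε hm hn c ?_ (auxP_eq hM hS)
      (auxQ_gen (N := M) (d := ε - 1) hε (by omega) (Or.inr ⟨hM, by omega⟩) hS)
    rw [hc]
    refine mul_pos two_pos (Real.sin_pos_of_pos_of_lt_pi (by positivity) ?_)
    rw [div_lt_iff₀ (by positivity)]
    nlinarith
  · rw [if_neg h] at hc
    have hcpos : 0 < c := by
      rw [hc]
      refine mul_pos two_pos (Real.sin_pos_of_pos_of_lt_pi (by positivity) ?_)
      rw [div_lt_iff₀ (by positivity)]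
      have : (0 : ℝ) ≤ (min ε η : ℕ) := Nat.cast_nonneg _
      nlinarith
    have hS := auxS_sin (2 * min ε η)
    have hl : 2 * Real.cos (Real.pi / ((2 * min ε η : ℕ) + 1)) = 2 - c ^ 2 := by
      rw [hc, key]
      congr 2
      push_cast
      have : (0 : ℝ) ≤ min (ε : ℝ) η := by positivity
      field_simp
      ring
    rw [hl] at hS
    rcases lt_or_gt_of_ne h with h1 | h1
    · rw [min_eq_left h1.le] at hS
      exact aux_main m n ε η hm hn c hcpos (auxP_swap (auxP_lt hS))
        (auxQ_swap (auxQ_gen (d := ε) hε h1 (Or.inl ⟨rfl, rfl⟩) hS))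
    · rw [min_eq_right h1.le] at hS
      exact aux_main m n ε η hm hn c hcpos (auxP_lt hS)
        (auxQ_gen (d := η) hη h1 (Or.inl ⟨rfl, rfl⟩) hS)
end

section
/- Let 𝕂 be ℝ or ℂ and let T, ΔT ∈ 𝕂^{p×q}. Suppose there is σ > 0 such that T·Tᴴ − σ²·I_p is positive semidefinite and the spectral norm satisfies ‖ΔT‖₂ < σ. Then for every b ∈ 𝕂^p the linear system (T+ΔT)x = b is consistent and has a solution x ∈ 𝕂^q with ‖x‖₂ ≤ ‖b‖₂/(σ − ‖ΔT‖₂). -/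
open Polynomial Matrix
open scoped ComplexOrder

/-- Euclidean norm of a (finitely indexed) vector over `𝕂 = ℝ` or `ℂ`. -/
noncomputable def evnorm {𝕂 : Type*} [RCLike 𝕂] {ι : Type*} [Fintype ι] (x : ι → 𝕂) : ℝ :=
  Real.sqrt (∑ i, ‖x i‖ ^ 2)

/-- Frobenius norm of a constant matrix over `𝕂 = ℝ` or `ℂ`. -/
noncomputable def frobNorm {𝕂 : Type*} [RCLike 𝕂] {ι κ : Type*} [Fintype ι] [Fintype κ]
    (A : Matrix ι κ 𝕂) : ℝ :=
  Real.sqrt (∑ i, ∑ j, ‖A i j‖ ^ 2)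

/-- Spectral norm (largest singular value; `ℓ²→ℓ²` operator norm) of a constant matrix:
the least `c ≥ 0` with `‖Ax‖₂ ≤ c‖x‖₂` for all `x`. -/
noncomputable def specNorm {𝕂 : Type*} [RCLike 𝕂] {ι κ : Type*} [Fintype ι] [Fintype κ]
    (A : Matrix ι κ 𝕂) : ℝ :=
  sInf {c : ℝ | 0 ≤ c ∧ ∀ x : κ → 𝕂, evnorm (A.mulVec x) ≤ c * evnorm x}

theorem aux_abstract {𝕂 E F : Type*} [RCLike 𝕂] [NormedAddCommGroup E] [InnerProductSpace 𝕂 E]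
    [NormedAddCommGroup F] [InnerProductSpace 𝕂 F] [FiniteDimensional 𝕂 E] [FiniteDimensional 𝕂 F]
    [CompleteSpace E] [CompleteSpace F]
    (S D : E →L[𝕂] F) (σ : ℝ)
    (hS : ∀ y, σ * ‖y‖ ≤ ‖ContinuousLinearMap.adjoint S y‖) (hD : ‖D‖ < σ) (b : F) :
    ∃ x, (S + D) x = b ∧ ‖x‖ ≤ ‖b‖ / (σ - ‖D‖) := by
  have hμ : 0 < σ - ‖D‖ := by linarith
  have hA : ∀ y, (σ - ‖D‖) * ‖y‖ ≤ ‖ContinuousLinearMap.adjoint (S + D) y‖ := by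
    intro y
    have h1 : ‖ContinuousLinearMap.adjoint D y‖ ≤ ‖D‖ * ‖y‖ := by
      have := (ContinuousLinearMap.adjoint D).le_opNorm y
      rwa [LinearIsometryEquiv.norm_map] at this
    have h2 := hS y
    have h3 : ContinuousLinearMap.adjoint (S + D) y =
        ContinuousLinearMap.adjoint S y + ContinuousLinearMap.adjoint D y := by
      rw [map_add]; rfl
    rw [h3]
    have h4 := norm_sub_le_norm_add (ContinuousLinearMap.adjoint S y)
      (ContinuousLinearMap.adjoint D y)
    linarith
  generalize S + D = A at hA ⊢
  have key : ∀ y, ‖ContinuousLinearMap.adjoint A y‖ ^ 2 ≤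
      ‖y‖ * ‖A (ContinuousLinearMap.adjoint A y)‖ := by
    intro y
    rw [← inner_self_eq_norm_sq (𝕜 := 𝕂), ContinuousLinearMap.adjoint_inner_left]
    exact re_inner_le_norm _ _
  let B : F →ₗ[𝕂] F := (A ∘L ContinuousLinearMap.adjoint A : F →L[𝕂] F)
  have hinj : Function.Injective B := by
    rw [injective_iff_map_eq_zero]
    intro y hy
    have h0 : A (ContinuousLinearMap.adjoint A y) = 0 := hy
    have h1 := key y
    rw [h0, norm_zero, mul_zero] at h1
    have h2 : ‖ContinuousLinearMap.adjoint A y‖ = 0 := by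
      have := sq_nonneg ‖ContinuousLinearMap.adjoint A y‖
      exact pow_eq_zero_iff two_ne_zero |>.1 (le_antisymm h1 this)
    have h3 := hA y
    rw [h2] at h3
    have : ‖y‖ ≤ 0 := by
      by_contra h
      push Not at h
      nlinarith [mul_pos hμ h]
    exact norm_le_zero_iff.1 this
  obtain ⟨y, hy⟩ := (LinearMap.injective_iff_surjective.1 hinj) b
  have h0 : A (ContinuousLinearMap.adjoint A y) = b := hy
  refine ⟨ContinuousLinearMap.adjoint A y, h0, ?_⟩
  have h1 := key y
  rw [h0] at h1
  have h2 := hA y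
  rw [le_div_iff₀ hμ]
  set n := ‖ContinuousLinearMap.adjoint A y‖
  have hn : 0 ≤ n := norm_nonneg _
  rcases hn.eq_or_lt with h | h
  · rw [← h]; simp
  · have h5 : n * (n * (σ - ‖D‖)) ≤ n * ‖b‖ := by
      nlinarith [mul_le_mul_of_nonneg_right h2 (norm_nonneg b),
        mul_le_mul_of_nonneg_right h1 hμ.le]
    exact le_of_mul_le_mul_left h5 h

theorem evnorm_eq {𝕂 : Type*} [RCLike 𝕂] {ι : Type*} [Fintype ι] (x : ι → 𝕂) :
    evnorm x = ‖(WithLp.toLp 2 x : EuclideanSpace 𝕂 ι)‖ := by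
  rw [EuclideanSpace.norm_eq]; rfl

theorem specNorm_eq {𝕂 : Type*} [RCLike 𝕂] {p q : ℕ} (A : Matrix (Fin p) (Fin q) 𝕂) :
    specNorm A = ‖(Matrix.toEuclideanLin A).toContinuousLinearMap‖ := by
  rw [ContinuousLinearMap.norm_def, specNorm]
  congr 1
  ext c
  refine and_congr_right fun _ => ⟨fun h x => ?_, fun h x => ?_⟩
  · have := h x.ofLp
    rw [evnorm_eq, evnorm_eq] at this
    exact this
  · have := h (WithLp.toLp 2 x)
    rw [evnorm_eq, evnorm_eq]
    exact this

/-- If `T·Tᴴ − σ²·I` is positive semidefinite (i.e. `σ` is a lower bound for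
the smallest singular value of `T`) and `‖ΔT‖₂ < σ`, then for every `b` the system
`(T+ΔT)x = b` is consistent and has a solution with `‖x‖₂ ≤ ‖b‖₂/(σ−‖ΔT‖₂)`. -/
theorem statement_9 {𝕂 : Type*} [RCLike 𝕂] (p q : ℕ)
    (T ΔT : Matrix (Fin p) (Fin q) 𝕂) (σ : ℝ) (hσ : 0 < σ)
    (hpsd : (T * T.conjTranspose - (σ ^ 2 : ℝ) • 1).PosSemidef)
    (hΔT : specNorm ΔT < σ) :
    ∀ b : Fin p → 𝕂, ∃ x : Fin q → 𝕂,
      (T + ΔT).mulVec x = b ∧ evnorm x ≤ evnorm b / (σ - specNorm ΔT) := by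
  intro b
  rw [specNorm_eq] at hΔT ⊢
  have hS : ∀ y, σ * ‖y‖ ≤ ‖ContinuousLinearMap.adjoint
      (Matrix.toEuclideanLin T).toContinuousLinearMap y‖ := by
    intro y
    have had : ContinuousLinearMap.adjoint (Matrix.toEuclideanLin T).toContinuousLinearMap y
        = WithLp.toLp 2 (T.conjTranspose.mulVec y.ofLp) := by
      have h := LinearMap.congr_fun (Matrix.toEuclideanLin_conjTranspose_eq_adjoint T) y
      exact h.symm
    rw [had]
    have h := hpsd.re_dotProduct_nonneg y.ofLp
    rw [Matrix.sub_mulVec, dotProduct_sub, map_sub, Matrix.smul_mulVec, Matrix.one_mulVec,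
      ← Matrix.mulVec_mulVec, Matrix.dotProduct_mulVec, dotProduct_smul, RCLike.smul_re] at h
    have e1 : star y.ofLp ᵥ* T = star (T.conjTranspose.mulVec y.ofLp) := by
      rw [Matrix.star_mulVec, Matrix.conjTranspose_conjTranspose]
    have e2 : ∀ (n : ℕ) (v : Fin n → 𝕂), RCLike.re (star v ⬝ᵥ v)
        = ‖(WithLp.toLp 2 v : EuclideanSpace 𝕂 (Fin n))‖ ^ 2 := by
      intro n v
      rw [← inner_self_eq_norm_sq (𝕜 := 𝕂), EuclideanSpace.inner_eq_star_dotProduct,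
        dotProduct_comm]
    rw [e1, e2, e2] at h
    refine (pow_le_pow_iff_left₀ (by positivity) (norm_nonneg _) two_ne_zero).1 ?_
    rw [mul_pow]
    have h' : ‖(WithLp.toLp 2 y.ofLp : EuclideanSpace 𝕂 (Fin p))‖ = ‖y‖ := rfl
    rw [h'] at h
    linarith
  obtain ⟨x, hx, hn⟩ := aux_abstract (Matrix.toEuclideanLin T).toContinuousLinearMap
    (Matrix.toEuclideanLin ΔT).toContinuousLinearMap σ hS hΔT (WithLp.toLp 2 b)
  · refine ⟨x.ofLp, ?_, ?_⟩
    · have h := congrArg WithLp.ofLp hx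
      rw [Matrix.add_mulVec]
      exact h
    · rw [evnorm_eq, evnorm_eq]
      exact hn
end

section
/- Let 𝕂 be ℝ or ℂ, m, n ≥ 1, ε, η ≥ 1, and let M_0, M_1, ΔA_{11}, ΔB_{11} ∈ 𝕂^{(η+1)m×(ε+1)n}, ΔA_{12}, ΔB_{12} ∈ 𝕂^{(η+1)m×ηm}, ΔA_{21}, ΔB_{21} ∈ 𝕂^{εn×(ε+1)n}, ΔA_{22}, ΔB_{22} ∈ 𝕂^{εn×ηm}. Set ΔT := [[−ΔA_{12}ᵀ⊗I_{εn}, −I_{ηm}⊗ΔA_{21}],[ΔB_{12}ᵀ⊗I_{εn}, I_{ηm}⊗ΔB_{21}]], let c := 2·sin(π/(4·min(ε,η)+2)) if ε ≠ η and c := 2·sin(π/(4η)) if ε = η (the smallest singular value of the unperturbed system matrix), and define δ := c − ‖ΔT‖₂, θ := sqrt(‖ΔA_{22}‖_F² + ‖ΔB_{22}‖_F²), ω := sqrt(‖M_0+ΔA_{11}‖_F² + ‖M_1+ΔB_{11}‖_F²). If δ > 0 and θω/δ² < 1/4, then there exist matrices C ∈ 𝕂^{εn×(η+1)m} and D ∈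 𝕂^{(ε+1)n×ηm} satisfying the quadratic Sylvester-like system C(E_{ηm}ᵀ − ΔA_{12}) + (E_{εn} − ΔA_{21})D = ΔA_{22} + C(M_0+ΔA_{11})D and C(F_{ηm}ᵀ + ΔB_{12}) + (F_{εn} + ΔB_{21})D = −ΔB_{22} − C(M_1+ΔB_{11})D, with sqrt(‖C‖_F² + ‖D‖_F²) ≤ 2θ/δ. -/
open Polynomial Matrix
open scoped Kronecker

lemma aux_rightInv {𝕂 V W : Type*} [RCLike 𝕂] [NormedAddCommGroup V] [InnerProductSpace 𝕂 V]
    [FiniteDimensional 𝕂 V] [NormedAddCommGroup W] [InnerProductSpace 𝕂 W] [FiniteDimensional 𝕂 W]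
    (S : V →ₗ[𝕂] W) (δ : ℝ) (hδ : 0 < δ) (h : ∀ y, δ * ‖y‖ ≤ ‖LinearMap.adjoint S y‖) :
    ∃ R : W →ₗ[𝕂] V, (∀ y, S (R y) = y) ∧ ∀ y, δ * ‖R y‖ ≤ ‖y‖ := by
  set P : W →ₗ[𝕂] W := S ∘ₗ LinearMap.adjoint S with hP
  have key : ∀ u, ‖LinearMap.adjoint S u‖ ^ 2 ≤ ‖P u‖ * ‖u‖ := by
    intro u
    have h1 : inner 𝕂 (P u) u
        = inner 𝕂 (LinearMap.adjoint S u) (LinearMap.adjoint S u) := by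
      rw [hP, LinearMap.comp_apply, LinearMap.adjoint_inner_right]
    have h2 := norm_inner_le_norm (𝕜 := 𝕂) (P u) u
    rw [h1, inner_self_eq_norm_sq_to_K] at h2
    simpa using h2
  have hinj : Function.Injective P := by
    rw [← LinearMap.ker_eq_bot, LinearMap.ker_eq_bot']
    intro u hu
    have h1 := key u
    rw [hu, norm_zero, zero_mul] at h1
    have h2 : ‖LinearMap.adjoint S u‖ = 0 := by
      have := sq_nonneg ‖LinearMap.adjoint S u‖
      exact pow_eq_zero_iff (two_ne_zero) |>.1 (le_antisymm h1 this)
    have h3 := h u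
    rw [h2] at h3
    have h4 : ‖u‖ = 0 := le_antisymm (by nlinarith [norm_nonneg u]) (norm_nonneg u)
    exact norm_eq_zero.1 h4
  set e := LinearEquiv.ofInjectiveEndo P hinj with he
  refine ⟨LinearMap.adjoint S ∘ₗ e.symm.toLinearMap, ?_, ?_⟩
  · intro y
    have : P (e.symm y) = y := e.apply_symm_apply y
    simpa [hP] using this
  · intro y
    have hy : P (e.symm y) = y := e.apply_symm_apply y
    have k := key (e.symm y)
    have k2 := h (e.symm y)
    rw [hy] at k
    simp only [LinearMap.comp_apply, LinearEquiv.coe_coe]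
    set a := ‖LinearMap.adjoint S (e.symm y)‖
    have ha : 0 ≤ a := norm_nonneg _
    rcases ha.eq_or_lt with h0 | h0
    · rw [← h0]; simp
    · have : δ * a ^ 2 ≤ ‖y‖ * a := by
        calc δ * a ^ 2 ≤ δ * (‖y‖ * ‖e.symm y‖) := by gcongr
          _ = ‖y‖ * (δ * ‖e.symm y‖) := by ring
          _ ≤ ‖y‖ * a := by gcongr
      nlinarith

lemma aux_fixed {𝕂 V W : Type*} [RCLike 𝕂] [NormedAddCommGroup V] [NormedSpace 𝕂 V]
    [CompleteSpace V] [NormedAddCommGroup W] [NormedSpace 𝕂 W]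
    (R : W →ₗ[𝕂] V) (q : V → W) (b : W) (δ θ ω : ℝ) (hδ : 0 < δ) (hω : 0 ≤ ω)
    (hR : ∀ y, δ * ‖R y‖ ≤ ‖y‖) (hb : ‖b‖ ≤ θ) (hq0 : q 0 = 0)
    (hq : ∀ z z', ‖q z - q z'‖ ≤ ω * (‖z‖ + ‖z'‖) * ‖z - z'‖)
    (hs : θ * ω / δ ^ 2 < 1 / 4) :
    ∃ z, z = R (b + q z) ∧ ‖z‖ ≤ 2 * θ / δ := by
  have hθ : 0 ≤ θ := (norm_nonneg b).trans hb
  have hR' : ∀ y, ‖R y‖ ≤ ‖y‖ / δ := fun y => by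
    rw [le_div_iff₀ hδ]; linarith [hR y]
  set ρ := 2 * θ / δ with hρ
  have hρ0 : 0 ≤ ρ := by positivity
  set k := 4 * (θ * ω / δ ^ 2) with hk
  have hk0 : 0 ≤ k := by positivity
  have hk1 : k < 1 := by linarith
  let f : V → V := fun z => R (b + q z)
  have hmaps : Set.MapsTo f (Metric.closedBall 0 ρ) (Metric.closedBall 0 ρ) := by
    intro z hz
    rw [mem_closedBall_zero_iff] at hz ⊢
    have h1 := hq z 0
    rw [hq0, sub_zero, sub_zero, norm_zero, add_zero] at h1
    have h2 : ‖q z‖ ≤ ω * ρ * ρ := h1.trans (by gcongr)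
    have h3 : ‖b + q z‖ ≤ θ + ω * ρ * ρ := (norm_add_le _ _).trans (by linarith)
    have h4 : ω * ρ * ρ = k * θ := by rw [hk, hρ]; field_simp; ring
    have h5 : ‖b + q z‖ ≤ 2 * θ := by nlinarith
    exact (hR' _).trans (by rw [hρ]; gcongr)
  have hlip : LipschitzOnWith ⟨k, hk0⟩ f (Metric.closedBall 0 ρ) := by
    apply LipschitzOnWith.of_dist_le_mul
    intro z hz z' hz'
    rw [mem_closedBall_zero_iff] at hz hz'
    rw [dist_eq_norm, dist_eq_norm]
    have : f z - f z' = R (q z - q z') := by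
      simp only [f]; rw [← map_sub]; congr 1; abel
    rw [this]
    calc ‖R (q z - q z')‖ ≤ ‖q z - q z'‖ / δ := hR' _
      _ ≤ (ω * (ρ + ρ) * ‖z - z'‖) / δ := by
          gcongr
          exact (hq z z').trans (by gcongr)
      _ = k * ‖z - z'‖ := by rw [hk, hρ]; field_simp; ring
  have hcontr : ContractingWith ⟨k, hk0⟩ (hmaps.restrict f _ _) :=
    ⟨by exact_mod_cast hk1, hlip.mapsToRestrict hmaps⟩
  obtain ⟨z, hz, hfix, -⟩ := ContractingWith.exists_fixedPoint'
    (Metric.isClosed_closedBall.isComplete) hmaps hcontr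
    (x := 0) (by simpa using hρ0) (edist_ne_top _ _)
  exact ⟨z, hfix.symm, by simpa using hz⟩

lemma aux_specNorm {𝕂 : Type*} [RCLike 𝕂] {ι κ : Type*} [Fintype ι] [Fintype κ]
    (A : Matrix ι κ 𝕂) (x : κ → 𝕂) : evnorm (A.mulVec x) ≤ specNorm A * evnorm x := by
  classical
  have hne : {c : ℝ | 0 ≤ c ∧ ∀ x : κ → 𝕂, evnorm (A.mulVec x) ≤ c * evnorm x}.Nonempty := by
    refine ⟨‖(Matrix.toEuclideanLin A).toContinuousLinearMap‖, norm_nonneg _, fun x => ?_⟩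
    have := (Matrix.toEuclideanLin A).toContinuousLinearMap.le_opNorm (WithLp.toLp 2 x)
    simpa [EuclideanSpace.norm_eq, evnorm] using this
  have hx : 0 ≤ evnorm x := Real.sqrt_nonneg _
  rcases hx.eq_or_lt with h0 | h0
  · obtain ⟨c, hc, h⟩ := hne
    have := h x
    rw [← h0] at this ⊢
    simpa using this
  · rw [← div_le_iff₀ h0]
    exact le_csInf hne fun c hc => by
      rw [div_le_iff₀ h0]; exact hc.2 x

lemma aux_1d {𝕂 : Type*} [RCLike 𝕂] (k : ℕ) (x y : Fin k → 𝕂) (α β : Fin k → ℝ)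
    (hα : ∀ i, 0 ≤ α i) (hβ : ∀ i, 0 ≤ β i)
    (h : ∀ i j : Fin k, (i : ℕ) = j + 1 → 1 ≤ α i * β j) :
    ∑ j, (1 - α j) * ‖x j‖ ^ 2 + ∑ j, (1 - β j) * ‖y j‖ ^ 2 ≤
    ∑ j : Fin (k + 1), ‖∑ j', EkMat 𝕂 k j' j * x j' + ∑ j', FkMat 𝕂 k j' j * y j'‖ ^ 2 := by
  set e : Fin (k+1) → 𝕂 := fun j => ∑ j', EkMat 𝕂 k j' j * x j' with he
  set f : Fin (k+1) → 𝕂 := fun j => ∑ j', FkMat 𝕂 k j' j * y j' with hf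
  have e1 : ∀ i : Fin k, e i.castSucc = x i := by
    intro i
    simp only [he, EkMat, Matrix.of_apply, Fin.val_castSucc, ← Fin.ext_iff, ite_mul, one_mul,
      zero_mul]
    simp
  have e2 : e (Fin.last k) = 0 := by
    apply Finset.sum_eq_zero
    intro i _
    have : k ≠ i := by omega
    simp [EkMat, this]
  have f1 : ∀ i : Fin k, f i.succ = y i := by
    intro i
    simp only [hf, FkMat, Matrix.of_apply, Fin.val_succ, add_left_inj, ← Fin.ext_iff, ite_mul,
      one_mul, zero_mul]
    simp
  have f2 : f 0 = 0 := by
    apply Finset.sum_eq_zero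
    intro i _
    simp [FkMat]
  let a : Fin (k+1) → ℝ := Fin.snoc (α := fun _ => ℝ) α 0
  let b : Fin (k+1) → ℝ := Fin.cons (α := fun _ => ℝ) 0 β
  have a1 : ∀ i : Fin k, a i.castSucc = α i := fun i => by simp [a]
  have a2 : a (Fin.last k) = 0 := by simp [a]
  have b1 : ∀ i : Fin k, b i.succ = β i := fun i => by simp [b]
  have b2 : b 0 = 0 := by simp [b]
  have ha : ∀ j, 0 ≤ a j := by
    intro j
    induction j using Fin.lastCases with
    | last => rw [a2]
    | cast i => rw [a1]; exact hα i
  have hb : ∀ j, 0 ≤ b j := by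
    intro j
    induction j using Fin.cases with
    | zero => rw [b2]
    | succ i => rw [b1]; exact hβ i
  have main : ∀ j, (1 - a j) * ‖e j‖ ^ 2 + (1 - b j) * ‖f j‖ ^ 2 ≤ ‖e j + f j‖ ^ 2 := by
    intro j
    by_cases h1 : e j = 0
    · rw [h1]; simp only [norm_zero, zero_add]
      nlinarith [hb j, sq_nonneg ‖f j‖]
    by_cases h2 : f j = 0
    · rw [h2]; simp only [norm_zero, add_zero]
      nlinarith [ha j, sq_nonneg ‖e j‖]
    have hab : 1 ≤ a j * b j := by
      obtain ⟨i, rfl⟩ | rfl := Fin.eq_castSucc_or_eq_last j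
      · rcases Fin.eq_zero_or_eq_succ i.castSucc with h3 | ⟨l, hl⟩
        · rw [h3, f2] at h2; exact absurd rfl h2
        · rw [a1, hl, b1]
          apply h
          have := congrArg Fin.val hl
          simpa using this
      · exact absurd e2 h1
    have h3 : |‖e j‖ - ‖f j‖| ≤ ‖e j + f j‖ := by
      have := abs_norm_sub_norm_le (e j) (-f j)
      simpa using this
    have h4 : (‖e j‖ - ‖f j‖) ^ 2 ≤ ‖e j + f j‖ ^ 2 := by
      rw [← sq_abs]; gcongr
    have hE := norm_nonneg (e j)
    have hF := norm_nonneg (f j)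
    generalize ‖e j‖ = p at *
    generalize ‖f j‖ = r at *
    have h5 : 2 * (p * r) ≤ a j * p ^ 2 + b j * r ^ 2 := by
      apply abs_le_of_sq_le_sq' _ _ |>.2
      · have : (p * r) ^ 2 ≤ (a j * b j) * (p * r) ^ 2 := by nlinarith [sq_nonneg (p * r)]
        nlinarith [sq_nonneg (a j * p ^ 2 - b j * r ^ 2)]
      · have := ha j; have := hb j; positivity
    nlinarith
  calc _ = ∑ j, ((1 - a j) * ‖e j‖ ^ 2 + (1 - b j) * ‖f j‖ ^ 2) := by
        rw [Finset.sum_add_distrib]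
        congr 1
        · rw [Fin.sum_univ_castSucc]; simp [e1, e2, a1]
        · rw [Fin.sum_univ_succ]; simp [f1, f2, b1]
    _ ≤ _ := Finset.sum_le_sum fun j _ => main j

lemma aux_2d {𝕂 : Type*} [RCLike 𝕂] (ε η : ℕ) (x y : Fin ε → Fin η → 𝕂) (u v : ℤ → ℤ → ℝ) (κ : ℝ)
    (hu : ∀ (i : Fin ε) (j : Fin η), 0 < u i j) (hv : ∀ (i : Fin ε) (j : Fin η), 0 < v i j)
    (hu1 : ∀ (i : Fin ε) (j : Fin η), 0 ≤ u (i + 1) j)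
    (hu2 : ∀ (i : Fin ε) (j : Fin η), 0 ≤ u i (j + 1))
    (hv1 : ∀ (i : Fin ε) (j : Fin η), 0 ≤ v (i - 1) j)
    (hv2 : ∀ (i : Fin ε) (j : Fin η), 0 ≤ v i (j - 1))
    (hus : ∀ i j : ℤ, v (i - 1) j + v i (j - 1) = κ * u i j)
    (hvs : ∀ i j : ℤ, u (i + 1) j + u i (j + 1) = κ * v i j) :
    (2 - κ) * (∑ i, ∑ j, ‖x i j‖ ^ 2 + ∑ i, ∑ j, ‖y i j‖ ^ 2) ≤
    ∑ i, ∑ j : Fin (η + 1), ‖∑ j', EkMat 𝕂 η j' j * x i j' + ∑ j', FkMat 𝕂 η j' j * y i j'‖ ^ 2 +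
    ∑ j, ∑ i : Fin (ε + 1),
      ‖∑ i', EkMat 𝕂 ε i' i * x i' j + ∑ i', FkMat 𝕂 ε i' i * y i' j‖ ^ 2 := by
  have r := fun i => aux_1d η (x i) (y i) (fun j => v i (j - 1) / u i j) (fun j => u i (j + 1) / v i j)
    (fun j => div_nonneg (hv2 i j) (hu i j).le) (fun j => div_nonneg (hu2 i j) (hv i j).le)
    (by
      intro j l hjl
      have h1 := hu i j
      have h2 := hv i l
      have : ((j : ℕ) : ℤ) = (l : ℕ) + 1 := by exact_mod_cast hjl
      rw [this] at h1 ⊢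
      rw [add_sub_cancel_right]
      apply le_of_eq
      field_simp)
  have s := fun j => aux_1d ε (fun i => x i j) (fun i => y i j)
    (fun i => v (i - 1) j / u i j) (fun i => u (i + 1) j / v i j)
    (fun i => div_nonneg (hv1 i j) (hu i j).le) (fun i => div_nonneg (hu1 i j) (hv i j).le)
    (by
      intro i l hjl
      have h1 := hu i j
      have h2 := hv l j
      have : ((i : ℕ) : ℤ) = (l : ℕ) + 1 := by exact_mod_cast hjl
      rw [this] at h1 ⊢
      rw [add_sub_cancel_right]
      apply le_of_eq
      field_simp)
  refine le_trans (le_of_eq ?_) (add_le_add (Finset.sum_le_sum fun i _ => r i)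
    (Finset.sum_le_sum fun j _ => s j))
  simp only [Finset.sum_add_distrib]
  rw [Finset.sum_comm (s := (Finset.univ : Finset (Fin η)))]
  rw [Finset.sum_comm (s := (Finset.univ : Finset (Fin η)))]
  rw [add_add_add_comm, mul_add]
  simp only [Finset.mul_sum, ← Finset.sum_add_distrib]
  refine Finset.sum_congr rfl fun i _ => Finset.sum_congr rfl fun j _ => ?_
  have h1 : v (i - 1) j / u i j + v i (j - 1) / u i j = κ := by
    rw [← add_div, hus, mul_div_assoc, div_self (hu i j).ne', mul_one]
  have h2 : u (i + 1) j / v i j + u i (j + 1) / v i j = κ := by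
    rw [← add_div, hvs, mul_div_assoc, div_self (hv i j).ne', mul_one]
  linear_combination (‖x i j‖ ^ 2) * h1 + (‖y i j‖ ^ 2) * h2

lemma aux_c {𝕂 : Type*} [RCLike 𝕂] (ε η : ℕ) (hε : 1 ≤ ε) (hη : 1 ≤ η) (c : ℝ)
    (hc : c = if ε = η then 2 * Real.sin (Real.pi / (4 * (η : ℝ)))
      else 2 * Real.sin (Real.pi / (4 * ((min ε η : ℕ) : ℝ) + 2)))
    (x y : Fin ε → Fin η → 𝕂) :
    c ^ 2 * (∑ i, ∑ j, ‖x i j‖ ^ 2 + ∑ i, ∑ j, ‖y i j‖ ^ 2) ≤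
    ∑ i, ∑ j : Fin (η + 1), ‖∑ j', EkMat 𝕂 η j' j * x i j' + ∑ j', FkMat 𝕂 η j' j * y i j'‖ ^ 2 +
    ∑ j, ∑ i : Fin (ε + 1),
      ‖∑ i', EkMat 𝕂 ε i' i * x i' j + ∑ i', FkMat 𝕂 ε i' i * y i' j‖ ^ 2 := by
  have hsq : ∀ t : ℝ, (2 * Real.sin t) ^ 2 = 2 - 2 * Real.cos (2 * t) := by
    intro t
    rw [Real.cos_two_mul, mul_pow, Real.sin_sq]; ring
  have hadd : ∀ s t : ℝ, Real.sin (s - t) + Real.sin (s + t) = 2 * Real.cos t * Real.sin s := by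
    intro s t
    rw [Real.sin_sub, Real.sin_add]; ring
  have hpos : ∀ L : ℝ, 0 < L → ∀ p : ℤ, 0 < p → (p : ℝ) < L → 0 < Real.sin (p * (Real.pi / L)) := by
    intro L hL p hp hpL
    have hp' : (0 : ℝ) < p := by exact_mod_cast hp
    apply Real.sin_pos_of_pos_of_lt_pi
    · have := Real.pi_pos; positivity
    · rw [← mul_div_assoc, div_lt_iff₀ hL]
      nlinarith [Real.pi_pos]
  have hnn : ∀ L : ℝ, 0 < L → ∀ p : ℤ, 0 ≤ p → (p : ℝ) ≤ L → 0 ≤ Real.sin (p * (Real.pi / L)) := by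
    intro L hL p hp hpL
    have hp' : (0 : ℝ) ≤ p := by exact_mod_cast hp
    apply Real.sin_nonneg_of_nonneg_of_le_pi
    · have := Real.pi_pos; positivity
    · rw [← mul_div_assoc, div_le_iff₀ hL]
      nlinarith [Real.pi_pos]
  have hε' : (1 : ℝ) ≤ ε := by exact_mod_cast hε
  have hη' : (1 : ℝ) ≤ η := by exact_mod_cast hη
  split_ifs at hc with he
  · subst he
    have hL : (0 : ℝ) < 2 * ε := by positivity
    set φ := Real.pi / (2 * (ε : ℝ)) with hφ
    have hc2 : c ^ 2 = 2 - 2 * Real.cos φ := by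
      rw [hc, hsq]; congr 3; rw [hφ]; field_simp; ring
    rw [hc2]
    apply aux_2d ε ε x y (fun i j => Real.sin (((i - j + ε : ℤ) : ℝ) * φ))
      (fun i j => Real.sin (((i - j + ε : ℤ) : ℝ) * φ))
    · intro i j
      exact hpos _ hL _ (by omega) (by
        have : ((i : ℕ) : ℤ) - (j : ℕ) + ε < 2 * ε := by omega
        exact_mod_cast this)
    · intro i j
      exact hpos _ hL _ (by omega) (by
        have : ((i : ℕ) : ℤ) - (j : ℕ) + ε < 2 * ε := by omega
        exact_mod_cast this)
    · intro i j
      exact hnn _ hL _ (by omega) (by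
        have : ((i : ℕ) : ℤ) + 1 - (j : ℕ) + ε ≤ 2 * ε := by omega
        exact_mod_cast this)
    · intro i j
      exact hnn _ hL _ (by omega) (by
        have : ((i : ℕ) : ℤ) - ((j : ℕ) + 1) + ε ≤ 2 * ε := by omega
        exact_mod_cast this)
    · intro i j
      exact hnn _ hL _ (by omega) (by
        have : ((i : ℕ) : ℤ) - 1 - (j : ℕ) + ε ≤ 2 * ε := by omega
        exact_mod_cast this)
    · intro i j
      exact hnn _ hL _ (by omega) (by
        have : ((i : ℕ) : ℤ) - ((j : ℕ) - 1) + ε ≤ 2 * ε := by omega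
        exact_mod_cast this)
    · intro i j
      rw [← hadd]; push_cast; congr 2 <;> ring
    · intro i j
      rw [← hadd, add_comm]; push_cast; congr 2 <;> ring
  · rcases le_total ε η with hle | hle
    · rw [min_eq_left hle] at hc
      have hL : (0 : ℝ) < 2 * ε + 1 := by positivity
      set φ := Real.pi / (2 * (ε : ℝ) + 1) with hφ
      have hc2 : c ^ 2 = 2 - 2 * Real.cos φ := by
        rw [hc, hsq]; congr 3; rw [hφ]; field_simp; ring
      rw [hc2]
      apply aux_2d ε η x y (fun i j => Real.sin (((2 * i + 1 : ℤ) : ℝ) * φ))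
        (fun i j => Real.sin (((2 * i + 2 : ℤ) : ℝ) * φ))
      · intro i j
        exact hpos _ hL _ (by omega) (by
          have : 2 * ((i : ℕ) : ℤ) + 1 < 2 * ε + 1 := by omega
          exact_mod_cast this)
      · intro i j
        exact hpos _ hL _ (by omega) (by
          have : 2 * ((i : ℕ) : ℤ) + 2 < 2 * ε + 1 := by omega
          exact_mod_cast this)
      · intro i j
        exact hnn _ hL _ (by omega) (by
          have : 2 * (((i : ℕ) : ℤ) + 1) + 1 ≤ 2 * ε + 1 := by omega
          exact_mod_cast this)
      · intro i j
        exact hnn _ hL _ (by omega) (by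
          have : 2 * ((i : ℕ) : ℤ) + 1 ≤ 2 * ε + 1 := by omega
          exact_mod_cast this)
      · intro i j
        exact hnn _ hL _ (by omega) (by
          have : 2 * (((i : ℕ) : ℤ) - 1) + 2 ≤ 2 * ε + 1 := by omega
          exact_mod_cast this)
      · intro i j
        exact hnn _ hL _ (by omega) (by
          have : 2 * ((i : ℕ) : ℤ) + 2 ≤ 2 * ε + 1 := by omega
          exact_mod_cast this)
      · intro i j
        rw [← hadd]; push_cast; congr 2 <;> ring
      · intro i j
        rw [← hadd, add_comm]; push_cast; congr 2 <;> ring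
    · rw [min_eq_right hle] at hc
      have hL : (0 : ℝ) < 2 * η + 1 := by positivity
      set φ := Real.pi / (2 * (η : ℝ) + 1) with hφ
      have hc2 : c ^ 2 = 2 - 2 * Real.cos φ := by
        rw [hc, hsq]; congr 3; rw [hφ]; field_simp; ring
      rw [hc2]
      apply aux_2d ε η x y (fun i j => Real.sin (((2 * j + 1 : ℤ) : ℝ) * φ))
        (fun i j => Real.sin (((2 * j + 2 : ℤ) : ℝ) * φ))
      · intro i j
        exact hpos _ hL _ (by omega) (by
          have : 2 * ((j : ℕ) : ℤ) + 1 < 2 * η + 1 := by omega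
          exact_mod_cast this)
      · intro i j
        exact hpos _ hL _ (by omega) (by
          have : 2 * ((j : ℕ) : ℤ) + 2 < 2 * η + 1 := by omega
          exact_mod_cast this)
      · intro i j
        exact hnn _ hL _ (by omega) (by
          have : 2 * ((j : ℕ) : ℤ) + 1 ≤ 2 * η + 1 := by omega
          exact_mod_cast this)
      · intro i j
        exact hnn _ hL _ (by omega) (by
          have : 2 * (((j : ℕ) : ℤ) + 1) + 1 ≤ 2 * η + 1 := by omega
          exact_mod_cast this)
      · intro i j
        exact hnn _ hL _ (by omega) (by
          have : 2 * ((j : ℕ) : ℤ) + 2 ≤ 2 * η + 1 := by omega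
          exact_mod_cast this)
      · intro i j
        exact hnn _ hL _ (by omega) (by
          have : 2 * (((j : ℕ) : ℤ) - 1) + 2 ≤ 2 * η + 1 := by omega
          exact_mod_cast this)
      · intro i j
        rw [← hadd, add_comm]; push_cast; congr 2 <;> ring
      · intro i j
        rw [← hadd]; push_cast; congr 2 <;> ring

lemma aux_c_nonneg (ε η : ℕ) (hε : 1 ≤ ε) (hη : 1 ≤ η) (c : ℝ)
    (hc : c = if ε = η then 2 * Real.sin (Real.pi / (4 * (η : ℝ)))
      else 2 * Real.sin (Real.pi / (4 * ((min ε η : ℕ) : ℝ) + 2))) : 0 ≤ c := by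
  have h : ∀ L : ℝ, 1 ≤ L → 0 ≤ 2 * Real.sin (Real.pi / L) := by
    intro L hL
    have := Real.pi_pos
    have := Real.sin_nonneg_of_nonneg_of_le_pi (x := Real.pi / L) (by positivity)
      (div_le_self this.le hL)
    positivity
  have hη' : (1 : ℝ) ≤ η := by exact_mod_cast hη
  rw [hc]
  split_ifs
  · exact h _ (by linarith)
  · exact h _ (by have : (0 : ℝ) ≤ ((min ε η : ℕ) : ℝ) := by positivity
                  linarith)

lemma aux_sum4 {J B I A : Type*} [Fintype J] [Fintype B] [Fintype I] [Fintype A]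
    (g : (J × B) × (I × A) → ℝ) :
    ∑ p, g p = ∑ b, ∑ a, ∑ i, ∑ j, g ((j, b), (i, a)) := by
  let e : B × A × I × J ≃ (J × B) × (I × A) :=
    ⟨fun q => ((q.2.2.2, q.1), (q.2.2.1, q.2.1)), fun p => (p.1.2, p.2.2, p.2.1, p.1.1),
      fun _ => rfl, fun _ => rfl⟩
  rw [← e.sum_comp]
  simp only [Fintype.sum_prod_type]
  rfl

/-- the unperturbed system matrix -/
def sysT (𝕂 : Type*) [RCLike 𝕂] (m n ε η : ℕ) :
    Matrix (((Fin η × Fin m) × (Fin ε × Fin n)) ⊕ ((Fin η × Fin m) × (Fin ε × Fin n)))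
      (((Fin (η + 1) × Fin m) × (Fin ε × Fin n)) ⊕ ((Fin η × Fin m) × (Fin (ε + 1) × Fin n))) 𝕂 :=
  Matrix.fromBlocks
    ((EkMat 𝕂 η ⊗ₖ (1 : Matrix (Fin m) (Fin m) 𝕂)) ⊗ₖ (1 : Matrix (Fin ε × Fin n) (Fin ε × Fin n) 𝕂))
    ((1 : Matrix (Fin η × Fin m) (Fin η × Fin m) 𝕂) ⊗ₖ (EkMat 𝕂 ε ⊗ₖ (1 : Matrix (Fin n) (Fin n) 𝕂)))
    ((FkMat 𝕂 η ⊗ₖ (1 : Matrix (Fin m) (Fin m) 𝕂)) ⊗ₖ (1 : Matrix (Fin ε × Fin n) (Fin ε × Fin n) 𝕂))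
    ((1 : Matrix (Fin η × Fin m) (Fin η × Fin m) 𝕂) ⊗ₖ (FkMat 𝕂 ε ⊗ₖ (1 : Matrix (Fin n) (Fin n) 𝕂)))

lemma aux_starE {𝕂 : Type*} [RCLike 𝕂] (k : ℕ) (i : Fin k) (j : Fin (k+1)) :
    (starRingEnd 𝕂) (EkMat 𝕂 k i j) = EkMat 𝕂 k i j := by
  simp only [EkMat, Matrix.of_apply]; split_ifs <;> simp

lemma aux_starF {𝕂 : Type*} [RCLike 𝕂] (k : ℕ) (i : Fin k) (j : Fin (k+1)) :
    (starRingEnd 𝕂) (FkMat 𝕂 k i j) = FkMat 𝕂 k i j := by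
  simp only [FkMat, Matrix.of_apply]; split_ifs <;> simp

lemma aux_Tinl {𝕂 : Type*} [RCLike 𝕂] (m n ε η : ℕ)
    (Y : (((Fin η × Fin m) × (Fin ε × Fin n)) ⊕ ((Fin η × Fin m) × (Fin ε × Fin n))) → 𝕂)
    (j : Fin (η + 1)) (b : Fin m) (i : Fin ε) (a : Fin n) :
    ((sysT 𝕂 m n ε η)ᴴ *ᵥ Y) (Sum.inl ((j, b), (i, a))) =
      ∑ j', EkMat 𝕂 η j' j * Y (Sum.inl ((j', b), (i, a))) +
      ∑ j', FkMat 𝕂 η j' j * Y (Sum.inr ((j', b), (i, a))) := by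
  simp only [Matrix.mulVec, dotProduct, sysT, Matrix.conjTranspose_apply, Fintype.sum_sum_type,
    Matrix.fromBlocks_apply₁₁, Matrix.fromBlocks_apply₂₁, Matrix.kroneckerMap_apply,
    Fintype.sum_prod_type, Matrix.one_apply, Prod.mk.injEq, RCLike.star_def, map_mul, aux_starE,
    aux_starF]
  simp [ite_and, apply_ite]

lemma aux_Tinr {𝕂 : Type*} [RCLike 𝕂] (m n ε η : ℕ)
    (Y : (((Fin η × Fin m) × (Fin ε × Fin n)) ⊕ ((Fin η × Fin m) × (Fin ε × Fin n))) → 𝕂)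
    (j : Fin η) (b : Fin m) (i : Fin (ε + 1)) (a : Fin n) :
    ((sysT 𝕂 m n ε η)ᴴ *ᵥ Y) (Sum.inr ((j, b), (i, a))) =
      ∑ i', EkMat 𝕂 ε i' i * Y (Sum.inl ((j, b), (i', a))) +
      ∑ i', FkMat 𝕂 ε i' i * Y (Sum.inr ((j, b), (i', a))) := by
  simp only [Matrix.mulVec, dotProduct, sysT, Matrix.conjTranspose_apply, Fintype.sum_sum_type,
    Matrix.fromBlocks_apply₁₂, Matrix.fromBlocks_apply₂₂, Matrix.kroneckerMap_apply,
    Fintype.sum_prod_type, Matrix.one_apply, Prod.mk.injEq, RCLike.star_def, map_mul, aux_starE,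
    aux_starF]
  simp [ite_and, apply_ite]

lemma aux_T {𝕂 : Type*} [RCLike 𝕂] (m n ε η : ℕ) (hε : 1 ≤ ε) (hη : 1 ≤ η) (c : ℝ)
    (hc : c = if ε = η then 2 * Real.sin (Real.pi / (4 * (η : ℝ)))
      else 2 * Real.sin (Real.pi / (4 * ((min ε η : ℕ) : ℝ) + 2)))
    (Y : (((Fin η × Fin m) × (Fin ε × Fin n)) ⊕ ((Fin η × Fin m) × (Fin ε × Fin n))) → 𝕂) :
    c * evnorm Y ≤ evnorm ((sysT 𝕂 m n ε η)ᴴ *ᵥ Y) := by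
  have hc0 := aux_c_nonneg ε η hε hη c hc
  unfold evnorm
  apply Real.le_sqrt_of_sq_le
  rw [mul_pow, Real.sq_sqrt (by positivity)]
  simp only [Fintype.sum_sum_type, aux_sum4, aux_Tinl, aux_Tinr]
  simp only [← Finset.sum_add_distrib]
  rw [Finset.mul_sum]
  refine Finset.sum_le_sum fun b _ => ?_
  rw [Finset.mul_sum]
  refine Finset.sum_le_sum fun a _ => ?_
  have := aux_c ε η hε hη c hc (fun i j => Y (Sum.inl ((j, b), (i, a))))
    (fun i j => Y (Sum.inr ((j, b), (i, a))))
  rw [Finset.sum_comm (s := (Finset.univ : Finset (Fin (ε + 1))))]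
  simpa only [Finset.sum_add_distrib, Finset.mul_sum] using this

lemma aux_frob_sq {𝕂 : Type*} [RCLike 𝕂] {ι κ : Type*} [Fintype ι] [Fintype κ]
    (A : Matrix ι κ 𝕂) : frobNorm A ^ 2 = ∑ i, ∑ j, ‖A i j‖ ^ 2 := by
  unfold frobNorm
  exact Real.sq_sqrt (by positivity)

open scoped Matrix.Norms.Frobenius in
lemma aux_frob_eq {𝕂 : Type*} [RCLike 𝕂] {ι κ : Type*} [Fintype ι] [Fintype κ]
    (A : Matrix ι κ 𝕂) : frobNorm A = ‖A‖ := by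
  rw [Matrix.frobenius_norm_def, frobNorm, Real.sqrt_eq_rpow]
  simp

lemma aux_frob_nonneg {𝕂 : Type*} [RCLike 𝕂] {ι κ : Type*} [Fintype ι] [Fintype κ]
    (A : Matrix ι κ 𝕂) : 0 ≤ frobNorm A := Real.sqrt_nonneg _

lemma aux_frob_neg {𝕂 : Type*} [RCLike 𝕂] {ι κ : Type*} [Fintype ι] [Fintype κ]
    (A : Matrix ι κ 𝕂) : frobNorm (-A) = frobNorm A := by
  simp [frobNorm]

open scoped Matrix.Norms.Frobenius in
lemma aux_triple {𝕂 : Type*} [RCLike 𝕂] {ι κ μ ν : Type*} [Fintype ι] [Fintype κ] [Fintype μ]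
    [Fintype ν] (C C' : Matrix ι κ 𝕂) (M : Matrix κ μ 𝕂) (D D' : Matrix μ ν 𝕂) :
    frobNorm (C * M * D - C' * M * D') ≤
      frobNorm M * (frobNorm (C - C') * frobNorm D + frobNorm C' * frobNorm (D - D')) := by
  simp only [aux_frob_eq]
  have : C * M * D - C' * M * D' = (C - C') * M * D + C' * M * (D - D') := by
    rw [Matrix.sub_mul, Matrix.sub_mul, Matrix.mul_sub]; abel
  rw [this]
  calc _ ≤ ‖(C - C') * M * D‖ + ‖C' * M * (D - D')‖ := norm_add_le _ _
    _ ≤ ‖C - C'‖ * ‖M‖ * ‖D‖ + ‖C'‖ * ‖M‖ * ‖D - D'‖ := by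
        gcongr
        · exact (Matrix.frobenius_norm_mul _ _).trans
            (by gcongr; exact Matrix.frobenius_norm_mul _ _)
        · exact (Matrix.frobenius_norm_mul _ _).trans
            (by gcongr; exact Matrix.frobenius_norm_mul _ _)
    _ = _ := by ring

lemma aux_evnorm {𝕂 : Type*} [RCLike 𝕂] {ι : Type*} [Fintype ι] (x : ι → 𝕂) :
    evnorm x = ‖WithLp.toLp 2 x‖ := by
  rw [EuclideanSpace.norm_eq, evnorm]

lemma aux_specNorm_adj {𝕂 : Type*} [RCLike 𝕂] {ι κ : Type*} [Fintype ι] [Fintype κ]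
    (A : Matrix ι κ 𝕂) (y : ι → 𝕂) : evnorm (Aᴴ *ᵥ y) ≤ specNorm A * evnorm y := by
  classical
  have h1 := aux_specNorm A (Aᴴ *ᵥ y)
  simp only [aux_evnorm] at *
  have h2 : ‖WithLp.toLp 2 (Aᴴ *ᵥ y)‖ ^ 2 ≤
      ‖WithLp.toLp 2 (A *ᵥ (Aᴴ *ᵥ y))‖ * ‖WithLp.toLp 2 y‖ := by
    have e1 : inner 𝕂 (Matrix.toEuclideanLin A (WithLp.toLp 2 (Aᴴ *ᵥ y))) (WithLp.toLp 2 y)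
        = inner 𝕂 (WithLp.toLp 2 (Aᴴ *ᵥ y)) (WithLp.toLp 2 (Aᴴ *ᵥ y)) := by
      rw [← LinearMap.adjoint_inner_right, ← Matrix.toEuclideanLin_conjTranspose_eq_adjoint]
      rfl
    have h2 := norm_inner_le_norm (𝕜 := 𝕂) (Matrix.toEuclideanLin A (WithLp.toLp 2 (Aᴴ *ᵥ y)))
      (WithLp.toLp 2 y)
    rw [e1, inner_self_eq_norm_sq_to_K] at h2
    have h3 : Matrix.toEuclideanLin A (WithLp.toLp 2 (Aᴴ *ᵥ y))
      = WithLp.toLp 2 (A *ᵥ (Aᴴ *ᵥ y)) := rfl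
    rw [h3] at h2
    simpa using h2
  have h0 : 0 ≤ specNorm A := Real.sInf_nonneg fun c hc => hc.1
  have ha := norm_nonneg (WithLp.toLp 2 (Aᴴ *ᵥ y))
  have hy := norm_nonneg (WithLp.toLp 2 y)
  generalize ‖WithLp.toLp 2 (Aᴴ *ᵥ y)‖ = p at *
  generalize ‖WithLp.toLp 2 y‖ = r at *
  rcases ha.eq_or_lt with h | h
  · rw [← h]; positivity
  · have : p * p ≤ (specNorm A * r) * p := by nlinarith
    exact le_of_mul_le_mul_right this h

lemma aux_norm_sum {𝕂 : Type*} [RCLike 𝕂] {I J K L : Type*} [Fintype I] [Fintype J] [Fintype K]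
    [Fintype L] (A : Matrix I J 𝕂) (B : Matrix K L 𝕂) :
    ‖(WithLp.toLp 2 (Sum.elim A.vec B.vec) : EuclideanSpace 𝕂 ((J × I) ⊕ (L × K)))‖ =
      Real.sqrt (frobNorm A ^ 2 + frobNorm B ^ 2) := by
  rw [EuclideanSpace.norm_eq, aux_frob_sq, aux_frob_sq]
  congr 1
  simp only [Fintype.sum_sum_type, Fintype.sum_prod_type, Sum.elim_inl, Sum.elim_inr, Matrix.vec]
  rw [Finset.sum_comm]
  congr 1
  rw [Finset.sum_comm]

lemma aux_exists_elim {𝕂 : Type*} [RCLike 𝕂] {I J K L : Type*} [Fintype I] [Fintype J] [Fintype K]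
    [Fintype L] (z : EuclideanSpace 𝕂 ((J × I) ⊕ (L × K))) :
    ∃ (A : Matrix I J 𝕂) (B : Matrix K L 𝕂), z = WithLp.toLp 2 (Sum.elim A.vec B.vec) := by
  refine ⟨Matrix.of fun i j => z (Sum.inl (j, i)), Matrix.of fun i j => z (Sum.inr (j, i)), ?_⟩
  ext p
  rcases p with p | p <;> rfl

/-- the quadratic term -/
noncomputable def quadQ {𝕂 : Type*} [RCLike 𝕂] {I J K L : Type*} [Fintype I] [Fintype J]
    [Fintype K] [Fintype L] (M N : Matrix J K 𝕂) (z : EuclideanSpace 𝕂 ((J × I) ⊕ (L × K))) :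
    EuclideanSpace 𝕂 ((L × I) ⊕ (L × I)) :=
  WithLp.toLp 2 (Sum.elim
    ((Matrix.of fun i j => z (Sum.inl (j, i))) * M * (Matrix.of fun i j => z (Sum.inr (j, i)))).vec
    (-((Matrix.of fun i j => z (Sum.inl (j, i))) * N *
      (Matrix.of fun i j => z (Sum.inr (j, i))))).vec)

lemma aux_quadQ {𝕂 : Type*} [RCLike 𝕂] {I J K L : Type*} [Fintype I] [Fintype J]
    [Fintype K] [Fintype L] (M N : Matrix J K 𝕂) (C : Matrix I J 𝕂) (D : Matrix K L 𝕂) :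
    quadQ M N (WithLp.toLp 2 (Sum.elim C.vec D.vec)) =
      WithLp.toLp 2 (Sum.elim (C * M * D).vec (-(C * N * D)).vec) := rfl

lemma aux_sub_elim {𝕂 : Type*} [RCLike 𝕂] {I J K L : Type*} [Fintype I] [Fintype J] [Fintype K]
    [Fintype L] (A A' : Matrix I J 𝕂) (B B' : Matrix K L 𝕂) :
    (WithLp.toLp 2 (Sum.elim A.vec B.vec) : EuclideanSpace 𝕂 ((J × I) ⊕ (L × K))) -
      WithLp.toLp 2 (Sum.elim A'.vec B'.vec) =
      WithLp.toLp 2 (Sum.elim (A - A').vec (B - B').vec) := by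
  ext p
  rcases p with p | p <;> rfl

lemma aux_add_elim {𝕂 : Type*} [RCLike 𝕂] {I J K L : Type*} [Fintype I] [Fintype J] [Fintype K]
    [Fintype L] (A A' : Matrix I J 𝕂) (B B' : Matrix K L 𝕂) :
    (WithLp.toLp 2 (Sum.elim A.vec B.vec) : EuclideanSpace 𝕂 ((J × I) ⊕ (L × K))) +
      WithLp.toLp 2 (Sum.elim A'.vec B'.vec) =
      WithLp.toLp 2 (Sum.elim (A + A').vec (B + B').vec) := by
  ext p
  rcases p with p | p <;> rfl

lemma aux_quad_lip {𝕂 : Type*} [RCLike 𝕂] {I J K L : Type*} [Fintype I] [Fintype J]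
    [Fintype K] [Fintype L] (M N : Matrix J K 𝕂) (z z' : EuclideanSpace 𝕂 ((J × I) ⊕ (L × K))) :
    ‖quadQ M N z - quadQ M N z'‖ ≤
      Real.sqrt (frobNorm M ^ 2 + frobNorm N ^ 2) * (‖z‖ + ‖z'‖) * ‖z - z'‖ := by
  obtain ⟨C, D, rfl⟩ := aux_exists_elim z
  obtain ⟨C', D', rfl⟩ := aux_exists_elim z'
  rw [aux_quadQ, aux_quadQ, aux_sub_elim, aux_sub_elim]
  have hN : -(C * N * D) - -(C' * N * D') = -(C * N * D - C' * N * D') := by abel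
  rw [hN, aux_norm_sum (C * M * D - C' * M * D'), aux_frob_neg, mul_assoc]
  have hl : ∀ a b : ℝ, a ≤ Real.sqrt (a ^ 2 + b ^ 2) := fun a b =>
    Real.le_sqrt_of_sq_le (by nlinarith [sq_nonneg b])
  have hr : ∀ a b : ℝ, b ≤ Real.sqrt (a ^ 2 + b ^ 2) := fun a b =>
    Real.le_sqrt_of_sq_le (by nlinarith [sq_nonneg a])
  have hX : frobNorm (C - C') * frobNorm D + frobNorm C' * frobNorm (D - D') ≤
      (‖(WithLp.toLp 2 (Sum.elim C.vec D.vec) : EuclideanSpace 𝕂 ((J × I) ⊕ (L × K)))‖ +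
      ‖(WithLp.toLp 2 (Sum.elim C'.vec D'.vec) : EuclideanSpace 𝕂 ((J × I) ⊕ (L × K)))‖) *
      ‖(WithLp.toLp 2 (Sum.elim (C - C').vec (D - D').vec) :
        EuclideanSpace 𝕂 ((J × I) ⊕ (L × K)))‖ := by
    simp only [aux_norm_sum]
    rw [add_mul, mul_comm (frobNorm (C - C'))]
    have := aux_frob_nonneg (C - C')
    have := aux_frob_nonneg (D - D')
    gcongr
    · exact hr _ _
    · exact hl _ _
    · exact hl _ _
    · exact hr _ _
  have hX0 : 0 ≤ frobNorm (C - C') * frobNorm D + frobNorm C' * frobNorm (D - D') := by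
    have := aux_frob_nonneg (C - C')
    have := aux_frob_nonneg (D - D')
    have := aux_frob_nonneg D
    have := aux_frob_nonneg C'
    positivity
  refine le_trans ?_ (mul_le_mul_of_nonneg_left hX (Real.sqrt_nonneg _))
  set X := frobNorm (C - C') * frobNorm D + frobNorm C' * frobNorm (D - D')
  have h1 := aux_triple C C' M D D'
  have h2 := aux_triple C C' N D D'
  apply Real.sqrt_le_iff.2 ⟨by positivity, ?_⟩
  rw [mul_pow, Real.sq_sqrt (by positivity), add_mul, ← mul_pow, ← mul_pow]
  have := aux_frob_nonneg (C * M * D - C' * M * D')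
  have := aux_frob_nonneg (C * N * D - C' * N * D')
  gcongr

/-- Under the hypotheses `δ > 0` and `θω/δ² < 1/4`, the quadratic
Sylvester-like system has a solution `(C, D)` with `sqrt(‖C‖_F² + ‖D‖_F²) ≤ 2θ/δ`. Here
`δ = c − ‖ΔT‖₂` with `c` the smallest singular value of the unperturbed system matrix `T`,
`θ = ‖(ΔA₂₂, ΔB₂₂)‖_F` and `ω = ‖(M₀+ΔA₁₁, M₁+ΔB₁₁)‖_F`. -/
theorem statement_10 {𝕂 : Type*} [RCLike 𝕂] (m n ε η : ℕ)
    (hm : 1 ≤ m) (hn : 1 ≤ n) (hε : 1 ≤ ε) (hη : 1 ≤ η)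
    (M0 M1 ΔA11 ΔB11 : Matrix (Fin (η + 1) × Fin m) (Fin (ε + 1) × Fin n) 𝕂)
    (ΔA12 ΔB12 : Matrix (Fin (η + 1) × Fin m) (Fin η × Fin m) 𝕂)
    (ΔA21 ΔB21 : Matrix (Fin ε × Fin n) (Fin (ε + 1) × Fin n) 𝕂)
    (ΔA22 ΔB22 : Matrix (Fin ε × Fin n) (Fin η × Fin m) 𝕂)
    (c δ θ ω : ℝ)
    (hc : c = if ε = η then 2 * Real.sin (Real.pi / (4 * (η : ℝ)))
      else 2 * Real.sin (Real.pi / (4 * ((min ε η : ℕ) : ℝ) + 2)))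
    (hδ : δ = c - specNorm (Matrix.fromBlocks
      ((-ΔA12.transpose) ⊗ₖ (1 : Matrix (Fin ε × Fin n) (Fin ε × Fin n) 𝕂))
      ((-1 : Matrix (Fin η × Fin m) (Fin η × Fin m) 𝕂) ⊗ₖ ΔA21)
      (ΔB12.transpose ⊗ₖ (1 : Matrix (Fin ε × Fin n) (Fin ε × Fin n) 𝕂))
      ((1 : Matrix (Fin η × Fin m) (Fin η × Fin m) 𝕂) ⊗ₖ ΔB21)))
    (hθ : θ = Real.sqrt (frobNorm ΔA22 ^ 2 + frobNorm ΔB22 ^ 2))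
    (hω : ω = Real.sqrt (frobNorm (M0 + ΔA11) ^ 2 + frobNorm (M1 + ΔB11) ^ 2))
    (hδpos : 0 < δ) (hsmall : θ * ω / δ ^ 2 < 1 / 4) :
    ∃ (C : Matrix (Fin ε × Fin n) (Fin (η + 1) × Fin m) 𝕂)
      (D : Matrix (Fin (ε + 1) × Fin n) (Fin η × Fin m) 𝕂),
      C * ((EkMat 𝕂 η ⊗ₖ (1 : Matrix (Fin m) (Fin m) 𝕂)).transpose - ΔA12) +
          ((EkMat 𝕂 ε ⊗ₖ (1 : Matrix (Fin n) (Fin n) 𝕂)) - ΔA21) * D =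
        ΔA22 + C * (M0 + ΔA11) * D ∧
      C * ((FkMat 𝕂 η ⊗ₖ (1 : Matrix (Fin m) (Fin m) 𝕂)).transpose + ΔB12) +
          ((FkMat 𝕂 ε ⊗ₖ (1 : Matrix (Fin n) (Fin n) 𝕂)) + ΔB21) * D =
        -ΔB22 - C * (M1 + ΔB11) * D ∧
      Real.sqrt (frobNorm C ^ 2 + frobNorm D ^ 2) ≤ 2 * θ / δ := by
  classical
  set ΔT := (Matrix.fromBlocks
      ((-ΔA12.transpose) ⊗ₖ (1 : Matrix (Fin ε × Fin n) (Fin ε × Fin n) 𝕂))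
      ((-1 : Matrix (Fin η × Fin m) (Fin η × Fin m) 𝕂) ⊗ₖ ΔA21)
      (ΔB12.transpose ⊗ₖ (1 : Matrix (Fin ε × Fin n) (Fin ε × Fin n) 𝕂))
      ((1 : Matrix (Fin η × Fin m) (Fin η × Fin m) 𝕂) ⊗ₖ ΔB21)) with hΔT
  set S := sysT 𝕂 m n ε η + ΔT with hS
  have hbound : ∀ y, δ * ‖y‖ ≤ ‖LinearMap.adjoint (Matrix.toEuclideanLin S) y‖ := by
    intro y
    rw [← Matrix.toEuclideanLin_conjTranspose_eq_adjoint]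
    have h1 := aux_T m n ε η hε hη c hc (WithLp.ofLp y)
    have h2 := aux_specNorm_adj ΔT (WithLp.ofLp y)
    simp only [aux_evnorm] at h1 h2
    have h3 : Matrix.toEuclideanLin Sᴴ y = WithLp.toLp 2 ((sysT 𝕂 m n ε η)ᴴ *ᵥ (WithLp.ofLp y)) +
        WithLp.toLp 2 (ΔTᴴ *ᵥ (WithLp.ofLp y)) := by
      rw [← WithLp.toLp_add, ← Matrix.add_mulVec, ← Matrix.conjTranspose_add]
      rfl
    rw [h3]
    have h4 := norm_sub_le_norm_add (WithLp.toLp 2 ((sysT 𝕂 m n ε η)ᴴ *ᵥ (WithLp.ofLp y)))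
      (WithLp.toLp 2 (ΔTᴴ *ᵥ (WithLp.ofLp y)))
    have h5 : WithLp.toLp 2 (WithLp.ofLp y) = y := rfl
    rw [h5] at h1 h2
    rw [hδ]
    linarith
  obtain ⟨R, hSR, hR⟩ := aux_rightInv (Matrix.toEuclideanLin S) δ hδpos hbound
  obtain ⟨z, hz, hzn⟩ := aux_fixed R (quadQ (M0 + ΔA11) (M1 + ΔB11))
    (WithLp.toLp 2 (Sum.elim ΔA22.vec (-ΔB22).vec)) δ θ ω hδpos (by rw [hω]; positivity) hR
    (by rw [aux_norm_sum, aux_frob_neg, hθ])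
    (by
      ext p
      rcases p with p | p <;> simp [quadQ, Matrix.vec, Matrix.mul_apply])
    (by rw [hω]; exact aux_quad_lip _ _) hsmall
  have hSz := hSR (WithLp.toLp 2 (Sum.elim ΔA22.vec (-ΔB22).vec) +
    quadQ (M0 + ΔA11) (M1 + ΔB11) z)
  rw [← hz] at hSz
  obtain ⟨C, D, rfl⟩ := aux_exists_elim z
  rw [aux_norm_sum] at hzn
  rw [aux_quadQ, aux_add_elim] at hSz
  have hSz' := congrArg WithLp.ofLp hSz
  have hS2 : S = Matrix.fromBlocks
      ((EkMat 𝕂 η ⊗ₖ (1 : Matrix (Fin m) (Fin m) 𝕂) - ΔA12ᵀ) ⊗ₖ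
        (1 : Matrix (Fin ε × Fin n) (Fin ε × Fin n) 𝕂))
      ((1 : Matrix (Fin η × Fin m) (Fin η × Fin m) 𝕂) ⊗ₖ
        (EkMat 𝕂 ε ⊗ₖ (1 : Matrix (Fin n) (Fin n) 𝕂) - ΔA21))
      ((FkMat 𝕂 η ⊗ₖ (1 : Matrix (Fin m) (Fin m) 𝕂) + ΔB12ᵀ) ⊗ₖ
        (1 : Matrix (Fin ε × Fin n) (Fin ε × Fin n) 𝕂))
      ((1 : Matrix (Fin η × Fin m) (Fin η × Fin m) 𝕂) ⊗ₖ
        (FkMat 𝕂 ε ⊗ₖ (1 : Matrix (Fin n) (Fin n) 𝕂) + ΔB21)) := by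
    rw [hS, hΔT, sysT, Matrix.fromBlocks_add, Matrix.add_kronecker, Matrix.kronecker_add,
      sub_eq_add_neg, sub_eq_add_neg, Matrix.add_kronecker, Matrix.kronecker_add]
    congr 2
    ext i j
    simp [Matrix.kroneckerMap_apply]
  have hS3 : S *ᵥ (Sum.elim C.vec D.vec) = Sum.elim (ΔA22 + C * (M0 + ΔA11) * D).vec
      (-ΔB22 + -(C * (M1 + ΔB11) * D)).vec := hSz'
  rw [hS2, Matrix.fromBlocks_mulVec] at hS3
  simp only [Sum.elim_comp_inl, Sum.elim_comp_inr, Matrix.kronecker_mulVec_vec, Matrix.one_mul,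
    Matrix.transpose_one, Matrix.mul_one, ← Matrix.vec_add] at hS3
  have e1 := congrArg (fun f => f ∘ Sum.inl) hS3
  simp only [Sum.elim_comp_inl, Matrix.vec_inj] at e1
  have e2 := congrArg (fun f => f ∘ Sum.inr) hS3
  simp only [Sum.elim_comp_inr, Matrix.vec_inj] at e2
  refine ⟨C, D, ?_, ?_, hzn⟩
  · rw [← e1]; simp
  · rw [sub_eq_add_neg, ← e2]; simp
end
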